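/- arXiv:0707.2143 — 2 statements merged into one kernel-verified Lean document; each statement's English description precedes it below -/
import Mathlib

section
/- (Elementary integration by parts formula, Theorem 2.2.) Let h^1,…,h^m : ℝ → ℝ be smooth bounded functions. On ℝ^{d+1} with coordinates (x,u), set X̄_i^t(x,u) = (X_i(x), h^i(t)) for i = 1,…,m and define the operator L̄^h_t on smooth F : ℝ^{d+1} → ℝ by L̄^h_t F(x,u) = ⟨X_0(x), ∇_x F⟩ + (1/2)∑_{i=1}^m ⟨DX_i(x)X_i(x), ∇_x F⟩ + (1/2)∑_{i=1}^m ⟨X̄_i^t(x,u), Hess F X̄_i^t(x,u)⟩. Fix T > 0 and a smooth bounded f : ℝ^d → ℝ. Suppose: (i) A : [0,T] × ℝ^d → ℝ is bounded, smooth, satisfies ∂_t A = L A with A(0,·) = f; (ii) B : [0,T] × ℝ^d → ℝ is bounded, smooth, B(0,·) = 0, and the function G(t,x,u) := A(t,x)·u + B(t,x) satisfies ∂_t G(t,x,u) = (L̄^h_t G(t,·,·))(x,u); (iii) Φ(s,t,x), defined for 0 ≤ s ≤ t ≤ T, is such that for each s the map (t,x) ↦ Φ(s,t,x) is smooth, bounded,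 satisfies ∂_t Φ(s,t,x) = (L Φ(s,t,·))(x) and Φ(s,s,x) = ∑_{i=1}^m h^i(s)⟨X_i(x), ∇_x A(s,x)⟩, with Φ, ∂_t Φ and the spatial derivatives of Φ up to order two continuous in (s,t,x) and locally bounded; (iv) any two bounded smooth solutions C : [0,T] × ℝ^d → ℝ of the inhomogeneous equation ∂_t C = L C + g, with g(t,x) = ∑_{i=1}^m h^i(t)⟨X_i(x), ∇_x A(t,x)⟩ and C(0,·) = 0, coincide. Then B(t,x) = ∫_0^t Φ(s,t,x) ds for all (t,x) ∈ [0,T] × ℝ^d; that is, G(t,x,0) equals the integrated term ∫_0^t P_{t-s}[∑_{i=1}^m h^i(s) X_i P_s f](x) ds in semigroup notation. -/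
open scoped BigOperators

/-- Bounded derivatives of all orders (order ≥ 1). -/
def BoundedDerivs {d : ℕ} (X : (Fin d → ℝ) → Fin d → ℝ) : Prop :=
  ∀ n : ℕ, 1 ≤ n → ∃ C : ℝ, ∀ x, ‖iteratedFDeriv ℝ n X x‖ ≤ C

/-- The Hörmander-type operator `L`. -/
noncomputable def hormanderL {d m : ℕ} (X : Fin (m + 1) → (Fin d → ℝ) → Fin d → ℝ)
    (f : (Fin d → ℝ) → ℝ) (x : Fin d → ℝ) : ℝ :=
  fderiv ℝ f x (X 0 x)
    + (1 / 2) * ∑ i : Fin m, fderiv ℝ f x (fderiv ℝ (X i.succ) x (X i.succ x))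
    + (1 / 2) * ∑ i : Fin m,
        fderiv ℝ (fun y => fderiv ℝ f y (X i.succ x)) x (X i.succ x)

/-- The operator `L̄^h_t` on functions of `(x,u)`, built from `X̄ᵢᵗ(x,u) = (Xᵢ(x), hⁱ(t))`. -/
noncomputable def barLh {d m : ℕ} (X : Fin (m + 1) → (Fin d → ℝ) → Fin d → ℝ)
    (h : Fin m → ℝ → ℝ) (t : ℝ) (F : (Fin d → ℝ) × ℝ → ℝ) (p : (Fin d → ℝ) × ℝ) : ℝ :=
  fderiv ℝ F p (X 0 p.1, 0)
    + (1 / 2) * ∑ i : Fin m, fderiv ℝ F p (fderiv ℝ (X i.succ) p.1 (X i.succ p.1), 0)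
    + (1 / 2) * ∑ i : Fin m,
        fderiv ℝ (fun q => fderiv ℝ F q (X i.succ p.1, h i t)) p (X i.succ p.1, h i t)

/-- The simplex `{(s,t) : 0 ≤ s ≤ t ≤ T}`. -/
def simplexST (T : ℝ) : Set (ℝ × ℝ) := {q | 0 ≤ q.1 ∧ q.1 ≤ q.2 ∧ q.2 ≤ T}

/-- `C` is a bounded smooth solution of the inhomogeneous equation
`∂ₜC = LC + ∑ᵢ hⁱ(t)⟨Xᵢ, ∇ₓA(t,·)⟩` on `[0,T]`. -/
def IsBddSolInhom {d m : ℕ} (X : Fin (m + 1) → (Fin d → ℝ) → Fin d → ℝ)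
    (h : Fin m → ℝ → ℝ) (T : ℝ) (A : ℝ → (Fin d → ℝ) → ℝ)
    (C : ℝ → (Fin d → ℝ) → ℝ) : Prop :=
  (∃ M : ℝ, ∀ t ∈ Set.Icc (0 : ℝ) T, ∀ x, |C t x| ≤ M) ∧
  ContDiffOn ℝ (⊤ : ℕ∞) (fun p : ℝ × (Fin d → ℝ) => C p.1 p.2) (Set.Icc (0 : ℝ) T ×ˢ Set.univ) ∧
  ∀ t ∈ Set.Icc (0 : ℝ) T, ∀ x,
    HasDerivWithinAt (fun s => C s x)
      (hormanderL X (C t) x + ∑ i : Fin m, h i t * fderiv ℝ (A t) x (X i.succ x))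
      (Set.Icc (0 : ℝ) T) t


open MeasureTheory Filter Topology Set

noncomputable def LrOp {E : Type*} [NormedAddCommGroup E] [NormedSpace ℝ E] {m : ℕ}
    (b : E) (v : Fin m → E) (f : E → ℝ) (x : E) (r : ℝ) : ℝ :=
  (f (x + r ^ 2 • b) - f x) / r ^ 2
    + (1 / 2) * ∑ i, (f (x + r • v i) + f (x - r • v i) - 2 * f x) / r ^ 2

section calc1
variable {E : Type*} [NormedAddCommGroup E] [NormedSpace ℝ E]

lemma fd_fd {f : E → ℝ} (hf : ContDiff ℝ 2 f) (v : E) :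
    Differentiable ℝ (fun y => fderiv ℝ f y v) := by
  have h1 : ContDiff ℝ 1 (fderiv ℝ f) := hf.fderiv_right (by norm_num)
  exact (h1.differentiable (by norm_num)).clm_apply (differentiable_const v)

lemma line_deriv {f : E → ℝ} (hf : Differentiable ℝ f) (x v : E) (r : ℝ) :
    HasDerivAt (fun r : ℝ => f (x + r • v)) (fderiv ℝ f (x + r • v) v) r := by
  have h1 : HasDerivAt (fun r : ℝ => x + r • v) v r := by
    simpa using ((hasDerivAt_id r).smul_const v).const_add x
  exact (hf (x + r • v)).hasFDerivAt.comp_hasDerivAt r h1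

lemma line_deriv' {f : E → ℝ} (hf : Differentiable ℝ f) (x v : E) (r : ℝ) :
    HasDerivAt (fun r : ℝ => f (x - r • v)) (- fderiv ℝ f (x - r • v) v) r := by
  have := line_deriv hf x (-v) r
  simpa [sub_eq_add_neg] using this

lemma diff2_tendsto {f : E → ℝ} (hf : ContDiff ℝ 2 f) (x v : E) :
    Tendsto (fun r : ℝ => (f (x + r • v) + f (x - r • v) - 2 * f x) / r ^ 2) (𝓝[>] 0)
      (𝓝 (fderiv ℝ (fun y => fderiv ℝ f y v) x v)) := by
  have hd : Differentiable ℝ f := hf.differentiable (by norm_num)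
  have hd2 := fd_fd hf v
  refine HasDerivAt.lhopital_zero_nhdsGT
    (f' := fun r => fderiv ℝ f (x + r • v) v - fderiv ℝ f (x - r • v) v)
    (g' := fun r => 2 * r) ?_ ?_ ?_ ?_ ?_ ?_
  · refine Eventually.of_forall fun r => ?_
    simpa [sub_eq_add_neg] using ((line_deriv hd x v r).add (line_deriv' hd x v r)).sub_const (2 * f x)
  · refine Eventually.of_forall fun r => ?_
    simpa using hasDerivAt_pow 2 r
  · filter_upwards [self_mem_nhdsWithin] with r hr
    have : (0:ℝ) < r := hr
    positivity
  · have hc : Continuous (fun r : ℝ => f (x + r • v) + f (x - r • v) - 2 * f x) := by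
      have := hd.continuous
      fun_prop
    have := (hc.tendsto 0).mono_left (nhdsWithin_le_nhds (s := Ioi 0))
    convert this using 2
    simp; ring
  · have hc : Continuous (fun r : ℝ => r ^ 2) := by fun_prop
    have := (hc.tendsto 0).mono_left (nhdsWithin_le_nhds (s := Ioi 0))
    simpa using this
  · have h1 := (line_deriv hd2 x v 0).sub (line_deriv' hd2 x v 0)
    have h2 := h1.tendsto_slope_zero_right
    have h3 := h2.const_mul (1/2)
    simp only [zero_smul, add_zero, sub_zero, zero_add, Pi.sub_apply, sub_self, smul_eq_mul] at h3
    refine (h3.congr' ?_).trans_eq ?_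
    · filter_upwards [self_mem_nhdsWithin] with r hr
      have : (0:ℝ) < r := hr
      field_simp
    · congr 1; ring

lemma diff1_tendsto {f : E → ℝ} (hf : Differentiable ℝ f) (x b : E) :
    Tendsto (fun r : ℝ => (f (x + r ^ 2 • b) - f x) / r ^ 2) (𝓝[>] 0)
      (𝓝 (fderiv ℝ f x b)) := by
  have h1 := (line_deriv hf x b 0).tendsto_slope_zero_right
  simp only [zero_smul, add_zero, zero_add, smul_eq_mul] at h1
  have h2 : Tendsto (fun r : ℝ => r ^ 2) (𝓝[>] 0) (𝓝[>] 0) := by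
    apply tendsto_nhdsWithin_of_tendsto_nhds_of_eventually_within
    · have hc : Continuous (fun r : ℝ => r ^ 2) := by fun_prop
      have := (hc.tendsto 0).mono_left (nhdsWithin_le_nhds (s := Ioi 0))
      simpa using this
    · filter_upwards [self_mem_nhdsWithin] with r hr
      have : (0:ℝ) < r := hr
      exact pow_pos this 2
  refine (h1.comp h2).congr fun r => ?_
  simp only [Function.comp]; ring

lemma LrOp_tendsto {m : ℕ} {f : E → ℝ} (hf : ContDiff ℝ 2 f) (x b : E) (v : Fin m → E) :
    Tendsto (LrOp b v f x) (𝓝[>] 0)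
      (𝓝 (fderiv ℝ f x b + (1/2) * ∑ i, fderiv ℝ (fun y => fderiv ℝ f y (v i)) x (v i))) := by
  unfold LrOp
  exact (diff1_tendsto (hf.differentiable (by norm_num)) x b).add
    ((tendsto_finsetSum _ fun i _ => diff2_tendsto hf x (v i)).const_mul _)

lemma diff1_bound {f : E → ℝ} (hf : Differentiable ℝ f) {C R : ℝ} {x b : E}
    (hC : ∀ y ∈ Metric.closedBall x R, ‖fderiv ℝ f y‖ ≤ C) (hb : ‖b‖ ≤ R) {r : ℝ} (hr : 0 < r)
    (hr1 : r ≤ 1) :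
    |(f (x + r ^ 2 • b) - f x) / r ^ 2| ≤ C * ‖b‖ := by
  have hR : 0 ≤ R := (norm_nonneg b).trans hb
  have hr2 : r ^ 2 ≤ 1 := pow_le_one₀ hr.le hr1
  have h := (convex_closedBall x R).norm_image_sub_le_of_norm_fderiv_le
    (fun y _ => hf y) hC (Metric.mem_closedBall_self hR)
    (y := x + r ^ 2 • b) (by
      simp only [Metric.mem_closedBall, dist_self_add_left, norm_smul, norm_pow, Real.norm_eq_abs, abs_of_pos hr]
      nlinarith [norm_nonneg b])
  rw [add_sub_cancel_left, norm_smul, norm_pow, Real.norm_eq_abs, Real.norm_eq_abs, abs_of_pos hr] at h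
  rw [abs_div, abs_of_pos (pow_pos hr 2), div_le_iff₀ (pow_pos hr 2)]
  linarith

lemma diff2_bound {f : E → ℝ} (hf : ContDiff ℝ 2 f) {C R : ℝ} {x v : E}
    (hC : ∀ y ∈ Metric.closedBall x R, ‖iteratedFDeriv ℝ 2 f y‖ ≤ C) (hb : ‖v‖ ≤ R) {r : ℝ}
    (hr : 0 < r) (hr1 : r ≤ 1) :
    |(f (x + r • v) + f (x - r • v) - 2 * f x) / r ^ 2| ≤ 2 * C * ‖v‖ ^ 2 := by
  have hR : 0 ≤ R := (norm_nonneg v).trans hb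
  have hd : Differentiable ℝ f := hf.differentiable (by norm_num)
  have h1 : ContDiff ℝ 1 (fderiv ℝ f) := hf.fderiv_right (by norm_num)
  have hC' : ∀ y ∈ Metric.closedBall x R, ‖fderiv ℝ (fderiv ℝ f) y‖ ≤ C := by
    intro y hy
    have := hC y hy
    rwa [← norm_iteratedFDeriv_fderiv (n := 1), norm_iteratedFDeriv_one] at this
  have hC0 : 0 ≤ C := (norm_nonneg _).trans (hC x (Metric.mem_closedBall_self hR))
  have key : ∀ ρ ∈ Icc (0:ℝ) r,
      ‖fderiv ℝ f (x + ρ • v) v - fderiv ℝ f (x - ρ • v) v‖ ≤ 2 * C * ‖v‖ ^ 2 * r := by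
    intro ρ hρ
    have hm1 : ‖ρ • v‖ ≤ R := by
      rw [norm_smul, Real.norm_eq_abs, abs_of_nonneg hρ.1]
      nlinarith [norm_nonneg v, hρ.1, hρ.2]
    have h := (convex_closedBall x R).norm_image_sub_le_of_norm_fderiv_le
      (fun y _ => h1.differentiable (by norm_num) y) hC' (x := x - ρ • v) (y := x + ρ • v)
      (by simpa using hm1) (by simpa using hm1)
    have e : x + ρ • v - (x - ρ • v) = (2 * ρ) • v := by rw [two_mul, add_smul]; abel
    rw [e, norm_smul, Real.norm_eq_abs, abs_of_nonneg (by linarith [hρ.1])] at h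
    rw [← sub_apply]
    refine (ContinuousLinearMap.le_opNorm _ _).trans ?_
    calc _ ≤ C * (2 * ρ * ‖v‖) * ‖v‖ := by gcongr
      _ = (2 * C * ‖v‖^2) * ρ := by ring
      _ ≤ _ := by gcongr; exact hρ.2
  have h := (convex_Icc (0:ℝ) r).norm_image_sub_le_of_norm_hasDerivWithin_le
    (f := fun r => f (x + r • v) + f (x - r • v))
    (fun ρ _ => ((line_deriv hd x v ρ).add (line_deriv' hd x v ρ)).hasDerivWithinAt)
    (by simpa [sub_eq_add_neg] using key) (left_mem_Icc.2 hr.le) (right_mem_Icc.2 hr.le)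
  simp only [zero_smul, add_zero, sub_zero, Real.norm_eq_abs, abs_of_pos hr] at h
  rw [abs_div, abs_of_pos (pow_pos hr 2), div_le_iff₀ (pow_pos hr 2)]
  calc _ = |f (x + r • v) + f (x - r • v) - (f x + f x)| := by congr 1; ring
    _ ≤ _ := h
    _ = _ := by ring

lemma LrOp_bound {m : ℕ} (x b : E) (v : Fin m → E) : ∃ R : ℝ, ∀ C, ∃ D, ∀ f : E → ℝ,
    ContDiff ℝ 2 f → (∀ y ∈ Metric.closedBall x R, ‖fderiv ℝ f y‖ ≤ C) →
    (∀ y ∈ Metric.closedBall x R, ‖iteratedFDeriv ℝ 2 f y‖ ≤ C) →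
    ∀ r, 0 < r → r ≤ 1 → |LrOp b v f x r| ≤ D := by
  refine ⟨‖b‖ + ∑ i, ‖v i‖, fun C => ⟨C * ‖b‖ + (1/2) * ∑ i, 2 * C * ‖v i‖ ^ 2, ?_⟩⟩
  intro f hf h1 h2 r hr hr1
  unfold LrOp
  have hs : 0 ≤ ∑ i, ‖v i‖ := Finset.sum_nonneg fun i _ => norm_nonneg _
  refine (abs_add_le _ _).trans (add_le_add ?_ ?_)
  · exact diff1_bound (hf.differentiable (by norm_num)) h1 (by linarith) hr hr1
  · rw [abs_mul, abs_of_pos (by norm_num : (0:ℝ) < 1/2)]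
    gcongr
    refine (Finset.abs_sum_le_sum_abs _ _).trans (Finset.sum_le_sum fun i _ => ?_)
    refine diff2_bound hf h2 ?_ hr hr1
    have := Finset.single_le_sum (f := fun i => ‖v i‖) (fun i _ => norm_nonneg _) (Finset.mem_univ i)
    have := norm_nonneg b
    linarith
end calc1

section maxp
variable {d m : ℕ}

noncomputable def sqf (x : Fin d → ℝ) : ℝ := 1 + ∑ j, x j ^ 2

lemma sqf_lower (x : Fin d → ℝ) : 1 + ‖x‖ ^ 2 ≤ sqf x := by
  unfold sqf
  rcases isEmpty_or_nonempty (Fin d) with hd | hd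
  · have : x = 0 := Subsingleton.elim _ _
    simp [this]
  · obtain ⟨j, hj⟩ := (Finset.exists_mem_eq_sup' Finset.univ_nonempty (fun j => ‖x j‖₊))
    have h1 : ‖x‖ = ‖x j‖ := by
      rw [Pi.norm_def, ← Finset.sup'_eq_sup Finset.univ_nonempty, hj.2]; rfl
    rw [h1, Real.norm_eq_abs, sq_abs]
    have := Finset.single_le_sum (f := fun j => x j ^ 2) (fun i _ => sq_nonneg _) (Finset.mem_univ j)
    linarith

lemma sum_mul_upper (x y : Fin d → ℝ) : ∑ j, x j * y j ≤ d * (‖x‖ * ‖y‖) := by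
  calc ∑ j, x j * y j ≤ ∑ j : Fin d, ‖x‖ * ‖y‖ := by
        refine Finset.sum_le_sum fun j _ => (le_abs_self _).trans ?_
        rw [abs_mul]
        exact mul_le_mul (norm_le_pi_norm x j) (norm_le_pi_norm y j) (abs_nonneg _) (norm_nonneg _)
    _ = _ := by simp

lemma sqf_add (x y : Fin d → ℝ) : sqf (x + y) = sqf x + 2 * ∑ j, x j * y j + ∑ j, y j * y j := by
  unfold sqf
  simp only [Pi.add_apply, add_sq, Finset.sum_add_distrib, Finset.mul_sum, mul_assoc]
  simp only [pow_two]
  ring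

lemma sqf_Lr (x b : Fin d → ℝ) (v : Fin m → Fin d → ℝ) {r : ℝ} (hr : 0 < r) :
    LrOp b v sqf x r = 2 * ∑ j, x j * b j + r ^ 2 * ∑ j, b j * b j + ∑ i, ∑ j, v i j * v i j := by
  have hr2 : r ^ 2 ≠ 0 := (pow_pos hr 2).ne'
  unfold LrOp
  have e1 : (sqf (x + r ^ 2 • b) - sqf x) / r ^ 2 = 2 * ∑ j, x j * b j + r ^ 2 * ∑ j, b j * b j := by
    rw [sqf_add, div_eq_iff hr2]
    simp only [Pi.smul_apply, smul_eq_mul]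
    have a1 : ∑ j, x j * (r ^ 2 * b j) = r ^ 2 * ∑ j, x j * b j := by
      rw [Finset.mul_sum]; exact Finset.sum_congr rfl fun j _ => by ring
    have a2 : ∑ j, (r ^ 2 * b j) * (r ^ 2 * b j) = r ^ 4 * ∑ j, b j * b j := by
      rw [Finset.mul_sum]; exact Finset.sum_congr rfl fun j _ => by ring
    rw [a1, a2]; ring
  have e2 : ∀ i, (sqf (x + r • v i) + sqf (x - r • v i) - 2 * sqf x) / r ^ 2
      = 2 * ∑ j, v i j * v i j := by
    intro i
    rw [sub_eq_add_neg x, sqf_add, sqf_add, div_eq_iff hr2]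
    simp only [Pi.smul_apply, Pi.neg_apply, smul_eq_mul]
    have a1 : ∑ j, x j * (r * v i j) = r * ∑ j, x j * v i j := by
      rw [Finset.mul_sum]; exact Finset.sum_congr rfl fun j _ => by ring
    have a1' : ∑ j, x j * (-(r * v i j)) = -r * ∑ j, x j * v i j := by
      rw [Finset.mul_sum]; exact Finset.sum_congr rfl fun j _ => by ring
    have a2 : ∑ j, (r * v i j) * (r * v i j) = r ^ 2 * ∑ j, v i j * v i j := by
      rw [Finset.mul_sum]; exact Finset.sum_congr rfl fun j _ => by ring
    have a2' : ∑ j, (-(r * v i j)) * (-(r * v i j)) = r ^ 2 * ∑ j, v i j * v i j := by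
      rw [Finset.mul_sum]; exact Finset.sum_congr rfl fun j _ => by ring
    rw [a1, a1', a2, a2']; ring
  rw [e1]
  simp only [e2]
  rw [← Finset.mul_sum]; ring

lemma LrOp_sub_mul {E : Type*} [NormedAddCommGroup E] [NormedSpace ℝ E] (b : E) (v : Fin m → E)
    (f g : E → ℝ) (c : ℝ) (x : E) (r : ℝ) :
    LrOp b v (fun y => f y + c * g y) x r = LrOp b v f x r + c * LrOp b v g x r := by
  unfold LrOp
  have : ∑ i, (f (x + r • v i) + c * g (x + r • v i) + (f (x - r • v i) + c * g (x - r • v i))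
        - 2 * (f x + c * g x)) / r ^ 2
      = ∑ i, (f (x + r • v i) + f (x - r • v i) - 2 * f x) / r ^ 2
      + c * ∑ i, (g (x + r • v i) + g (x - r • v i) - 2 * g x) / r ^ 2 := by
    rw [Finset.mul_sum, ← Finset.sum_add_distrib]
    exact Finset.sum_congr rfl fun i _ => by ring
  rw [this]; ring

theorem max_principle {T : ℝ} (hT : 0 < T) (b : (Fin d → ℝ) → Fin d → ℝ)
    (v : (Fin d → ℝ) → Fin m → Fin d → ℝ) {K : ℝ}
    (hb : ∀ x, ‖b x‖ ≤ K * (1 + ‖x‖)) (hv : ∀ x i, ‖v x i‖ ≤ K * (1 + ‖x‖))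
    (U : ℝ → (Fin d → ℝ) → ℝ)
    (hUc : ContinuousOn (fun p : ℝ × (Fin d → ℝ) => U p.1 p.2) (Icc 0 T ×ˢ univ))
    {M : ℝ} (hM : ∀ t ∈ Icc 0 T, ∀ x, U t x ≤ M) (hU0 : ∀ x, U 0 x ≤ 0)
    (hU : ∀ t, 0 < t → t ≤ T → ∀ x, ∃ l, Tendsto (LrOp (b x) (v x) (U t) x) (𝓝[>] 0) (𝓝 l) ∧
      ∀ c, l < c → ∀ᶠ η in 𝓝[>] (0:ℝ), U t x - U (t - η) x ≤ c * η) :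
    ∀ t ∈ Icc 0 T, ∀ x, U t x ≤ 0 := by
  have hK : 0 ≤ K := by
    have := (norm_nonneg _).trans (hb 0)
    simpa using this
  -- growth constant
  obtain ⟨lam, hlam0, hlam⟩ : ∃ lam : ℝ, 0 ≤ lam ∧ ∀ x,
      2 * ∑ j, x j * b x j + ∑ i, ∑ j, v x i j * v x i j ≤ lam * sqf x := by
    refine ⟨4 * d * K + m * (2 * d * K ^ 2), by positivity, fun x => ?_⟩
    have h0 := norm_nonneg x
    have h1 := sum_mul_upper x (b x)
    have h2 : ∑ i, ∑ j, v x i j * v x i j ≤ ∑ i : Fin m, d * (K * (1 + ‖x‖) * (K * (1 + ‖x‖))) := by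
      refine Finset.sum_le_sum fun i _ => (sum_mul_upper _ _).trans ?_
      gcongr <;> exact hv x i
    rw [Finset.sum_const, Finset.card_univ, Fintype.card_fin, nsmul_eq_mul] at h2
    have h3 : ∑ j, x j * b x j ≤ d * (‖x‖ * (K * (1 + ‖x‖))) := h1.trans (by gcongr; exact hb x)
    have h4 := sqf_lower x
    have h5 : ‖x‖ * (1 + ‖x‖) ≤ 2 * sqf x := by nlinarith [sq_nonneg (1 - ‖x‖)]
    have h6 : (1 + ‖x‖) * (1 + ‖x‖) ≤ 2 * sqf x := by nlinarith [sq_nonneg (1 - ‖x‖)]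
    have h7 : d * (‖x‖ * (K * (1 + ‖x‖))) ≤ d * K * (2 * sqf x) := by
      calc _ = d * K * (‖x‖ * (1 + ‖x‖)) := by ring
        _ ≤ _ := by gcongr
    have h8 : (m:ℝ) * (d * (K * (1 + ‖x‖) * (K * (1 + ‖x‖)))) ≤ m * (d * K ^ 2) * (2 * sqf x) := by
      calc _ = m * (d * K ^ 2) * ((1 + ‖x‖) * (1 + ‖x‖)) := by ring
        _ ≤ _ := by gcongr
    nlinarith
  intro t1 ht1 x1
  by_contra! hpos
  set μ := lam + 1 with hμ
  set ε := U t1 x1 / (2 * (Real.exp (μ * t1) * sqf x1)) with hε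
  have sqpos : ∀ x : Fin d → ℝ, 1 ≤ sqf x := fun x => by
    have := sqf_lower x; nlinarith [sq_nonneg ‖x‖]
  have hs1 : 0 < sqf x1 := by linarith [sqpos x1]
  have hεpos : 0 < ε := by positivity
  set V : ℝ × (Fin d → ℝ) → ℝ := fun p => U p.1 p.2 + (-(ε * Real.exp (μ * p.1))) * sqf p.2 with hV
  have hV1 : 0 < V (t1, x1) := by
    have : ε * (Real.exp (μ * t1) * sqf x1) = U t1 x1 / 2 := by
      rw [hε]; field_simp
    simp only [hV]; nlinarith
  -- compactness
  set R := ‖x1‖ + |M| / ε with hR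
  have hout : ∀ t ∈ Icc 0 T, ∀ x : Fin d → ℝ, R < ‖x‖ → V (t, x) < 0 := by
    intro t ht x hx
    have h1 : 1 ≤ Real.exp (μ * t) := Real.one_le_exp (by have := ht.1; positivity)
    have h2 := sqf_lower x
    have h3 : |M| / ε < sqf x := by
      have : |M| / ε < ‖x‖ := by linarith [norm_nonneg x1]
      nlinarith [sq_nonneg (‖x‖ - 1)]
    have h4 : |M| < sqf x * ε := by rwa [div_lt_iff₀ hεpos] at h3
    have h5 := hM t ht x
    have h6 : sqf x * ε * 1 ≤ sqf x * ε * Real.exp (μ * t) := by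
      have := sqpos x
      gcongr
    have := le_abs_self M
    simp only [hV]; nlinarith
  have hsqc : Continuous (sqf : (Fin d → ℝ) → ℝ) := by unfold sqf; fun_prop
  have hVc : ContinuousOn V (Icc 0 T ×ˢ univ) := by
    refine hUc.add (Continuous.continuousOn ?_)
    fun_prop
  have hcomp : IsCompact (Icc (0:ℝ) T ×ˢ Metric.closedBall (0 : Fin d → ℝ) R) :=
    isCompact_Icc.prod (isCompact_closedBall _ _)
  have hx1m : (t1, x1) ∈ Icc (0:ℝ) T ×ˢ Metric.closedBall (0 : Fin d → ℝ) R := by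
    refine ⟨ht1, ?_⟩
    simp only [mem_closedBall_zero_iff, hR]
    have : 0 ≤ |M| / ε := by positivity
    linarith
  obtain ⟨⟨t0, x0⟩, hp0, hmax⟩ := hcomp.exists_isMaxOn ⟨_, hx1m⟩
    (hVc.mono (prod_mono_right (subset_univ _)))
  have hpos0 : 0 < V (t0, x0) := hV1.trans_le (hmax hx1m)
  have hmax' : ∀ t ∈ Icc 0 T, ∀ x, V (t, x) ≤ V (t0, x0) := by
    intro t ht x
    by_cases hx : ‖x‖ ≤ R
    · exact hmax (show (t, x) ∈ _ from ⟨ht, by simpa using hx⟩)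
    · exact ((hout t ht x (not_le.1 hx)).trans hpos0).le
  have ht0 : t0 ∈ Icc 0 T := hp0.1
  have hs0 : 0 < sqf x0 := by linarith [sqpos x0]
  have ht0pos : 0 < t0 := by
    rcases ht0.1.eq_or_lt with h | h
    · exfalso
      subst h
      have := hU0 x0
      simp only [hV, mul_zero, Real.exp_zero] at hpos0
      nlinarith
    · exact h
  obtain ⟨l, hl, hinc⟩ := hU t0 ht0pos ht0.2 x0
  set e0 := Real.exp (μ * t0) with he0
  have he0p : 0 < e0 := Real.exp_pos _
  -- second order condition
  have hle : l ≤ ε * e0 * (lam * sqf x0) := by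
    have h1 : Tendsto (fun r : ℝ => ε * e0 * (2 * ∑ j, x0 j * b x0 j + r ^ 2 * ∑ j, b x0 j * b x0 j
        + ∑ i, ∑ j, v x0 i j * v x0 i j)) (𝓝[>] 0)
        (𝓝 (ε * e0 * (2 * ∑ j, x0 j * b x0 j + 0 ^ 2 * ∑ j, b x0 j * b x0 j
        + ∑ i, ∑ j, v x0 i j * v x0 i j))) := by
      refine (Continuous.tendsto ?_ 0).mono_left nhdsWithin_le_nhds
      fun_prop
    have h2 := le_of_tendsto_of_tendsto hl h1 (by
      filter_upwards [self_mem_nhdsWithin] with r hr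
      have hr : 0 < r := hr
      rw [← sqf_Lr x0 (b x0) (v x0) hr]
      have h3 := LrOp_sub_mul (b x0) (v x0) (U t0) sqf (-(ε * e0)) x0 r
      have h4 : LrOp (b x0) (v x0) (fun y => U t0 y + -(ε * e0) * sqf y) x0 r ≤ 0 := by
        unfold LrOp
        have hm : ∀ y, U t0 y + -(ε * e0) * sqf y ≤ U t0 x0 + -(ε * e0) * sqf x0 :=
          fun y => hmax' t0 ht0 y
        have g1 : (U t0 (x0 + r ^ 2 • b x0) + -(ε * e0) * sqf (x0 + r ^ 2 • b x0)
            - (U t0 x0 + -(ε * e0) * sqf x0)) / r ^ 2 ≤ 0 :=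
          div_nonpos_of_nonpos_of_nonneg (by linarith [hm (x0 + r ^ 2 • b x0)]) (by positivity)
        have g2 : ∑ i, (U t0 (x0 + r • v x0 i) + -(ε * e0) * sqf (x0 + r • v x0 i) +
            (U t0 (x0 - r • v x0 i) + -(ε * e0) * sqf (x0 - r • v x0 i))
            - 2 * (U t0 x0 + -(ε * e0) * sqf x0)) / r ^ 2 ≤ 0 :=
          Finset.sum_nonpos fun i _ => div_nonpos_of_nonpos_of_nonneg
            (by linarith [hm (x0 + r • v x0 i), hm (x0 - r • v x0 i)]) (by positivity)
        linarith
      linarith)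
    refine h2.trans ?_
    have := hlam x0
    rw [zero_pow two_ne_zero, zero_mul, add_zero]
    gcongr
  -- time condition
  have hlt : l < ε * e0 * ((lam + 1/2) * sqf x0) := by
    refine hle.trans_lt ?_
    have : lam * sqf x0 < (lam + 1/2) * sqf x0 := by nlinarith
    gcongr
  have h1 := hinc _ hlt
  have hder : HasDerivAt (fun η : ℝ => - Real.exp (μ * (t0 - η))) (μ * e0) 0 := by
    have : HasDerivAt (fun η : ℝ => μ * (t0 - η)) (-μ) 0 := by
      simpa using ((hasDerivAt_id (0:ℝ)).const_sub t0).const_mul μ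
    refine this.exp.neg.congr_deriv ?_
    rw [he0, sub_zero]; ring
  have h2 := hder.tendsto_slope_zero_right
  have h3 : ∀ᶠ η in 𝓝[>] (0:ℝ), (lam + 1/2) * e0 < η⁻¹ • (- Real.exp (μ * (t0 - (0 + η))) - - Real.exp (μ * (t0 - 0))) :=
    h2.eventually_const_lt (by rw [hμ]; nlinarith)
  have h4 : ∀ᶠ η in 𝓝[>] (0:ℝ), η < t0 :=
    (eventually_lt_nhds ht0pos).filter_mono nhdsWithin_le_nhds
  obtain ⟨η, ⟨g1, g2⟩, g3, g4⟩ := ((h1.and h3).and (h4.and self_mem_nhdsWithin)).exists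
  have g4 : 0 < η := g4
  simp only [zero_add, sub_zero, smul_eq_mul] at g2
  rw [← he0, inv_mul_eq_div, lt_div_iff₀ g4] at g2
  have g5 := hmax' (t0 - η) ⟨by linarith, by linarith [ht0.2]⟩ x0
  simp only [hV] at g5
  rw [← he0] at g5
  have g6 : ε * sqf x0 * ((lam + 1 / 2) * e0 * η) < ε * sqf x0 * (-Real.exp (μ * (t0 - η)) - -e0) := by
    gcongr
  nlinarith
end maxp

section cth

lemma th_int {θ f : ℝ → ℝ} (hθ : Measurable θ) (hθ1 : ∀ s, |θ s| ≤ 1) {a b : ℝ}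
    (hf : IntervalIntegrable f volume a b) :
    IntervalIntegrable (fun s => θ s * f s) volume a b := by
  rw [intervalIntegrable_iff] at hf ⊢
  exact Integrable.bdd_mul (c := 1) hf hθ.aestronglyMeasurable (Eventually.of_forall hθ1)

lemma ii_of {f : ℝ → ℝ} {a b t : ℝ} (hf : ContinuousOn f (Icc 0 t)) (ha : 0 ≤ a) (hab : a ≤ b)
    (hb : b ≤ t) : IntervalIntegrable f volume a b :=
  (hf.mono (by rw [uIcc_of_le hab]; exact Icc_subset_Icc ha hb)).intervalIntegrable

lemma ind_meas {f : ℝ → ℝ} {a t : ℝ} (ha : 0 ≤ a) (hat : a ≤ t)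
    (h : IntervalIntegrable f volume 0 a) :
    AEStronglyMeasurable ({s | s ≤ a}.indicator f) (volume.restrict (uIoc 0 t)) := by
  change AEStronglyMeasurable ((Iic a).indicator f) _
  rw [aestronglyMeasurable_indicator_iff measurableSet_Iic, Measure.restrict_restrict measurableSet_Iic,
    uIoc_of_le (ha.trans hat), inter_comm, Ioc_inter_Iic, min_eq_right hat]
  exact ((intervalIntegrable_iff_integrableOn_Ioc_of_le ha).1 h).aestronglyMeasurable

lemma left_incr (φ φ' : ℝ → ℝ → ℝ) {T t D : ℝ} (ht : 0 < t) (htT : t ≤ T)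
    (hd : ∀ s τ, 0 ≤ s → s ≤ τ → τ ≤ T → HasDerivWithinAt (φ s) (φ' s τ) (Icc s T) τ)
    (hb : ∀ s τ, 0 ≤ s → s ≤ τ → τ ≤ T → |φ' s τ| ≤ D)
    (hc : ∀ τ ∈ Icc 0 T, ContinuousOn (fun s => φ s τ) (Icc 0 τ))
    {θ : ℝ → ℝ} (hθ : Measurable θ) (hθ1 : ∀ s, |θ s| ≤ 1) {γ : ℝ}
    (hγ : ∀ δ > 0, ∀ᶠ s in 𝓝[<] t, θ s * φ s t ≤ γ + δ) :
    ∀ c, γ + ∫ s in (0:ℝ)..t, θ s * φ' s t < c → ∀ᶠ η in 𝓝[>] (0:ℝ),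
      (∫ s in (0:ℝ)..t, θ s * φ s t) - ∫ s in (0:ℝ)..(t - η), θ s * φ s (t - η) ≤ c * η := by
  intro c hcc
  have hii : ∀ τ ∈ Icc 0 T, ∀ a b, 0 ≤ a → a ≤ b → b ≤ τ →
      IntervalIntegrable (fun s => θ s * φ s τ) volume a b := fun τ hτ a b ha hab hb =>
    th_int hθ hθ1 (ii_of (hc τ hτ) ha hab hb)
  have hsmall : ∀ᶠ η in 𝓝[>] (0:ℝ), η < t :=
    (eventually_lt_nhds ht).filter_mono nhdsWithin_le_nhds
  have hD : 0 ≤ D := (abs_nonneg _).trans (hb 0 0 le_rfl le_rfl (ht.le.trans htT))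
  -- the second part
  have hlim : Tendsto (fun η : ℝ => ∫ s in (0:ℝ)..t,
      {s | s ≤ t - η}.indicator (fun s => θ s * ((φ s t - φ s (t - η)) / η)) s) (𝓝[>] 0)
      (𝓝 (∫ s in (0:ℝ)..t, θ s * φ' s t)) := by
    refine intervalIntegral.tendsto_integral_filter_of_dominated_convergence (fun _ => D) ?_ ?_ ?_ ?_
    · filter_upwards [hsmall, self_mem_nhdsWithin] with η h1 h2
      have h2 : 0 < η := h2
      have h3 : IntervalIntegrable (fun s => θ s * ((φ s t - φ s (t - η)) / η)) volume 0 (t - η) := by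
        refine th_int hθ hθ1 ?_
        have i1 := ii_of (a := 0) (b := t - η) (hc t ⟨ht.le, htT⟩) le_rfl (by linarith) (by linarith)
        have i2 := ii_of (a := 0) (b := t - η) (hc (t - η) ⟨by linarith, by linarith⟩) le_rfl (by linarith) le_rfl
        exact (i1.sub i2).div_const η
      exact ind_meas (by linarith) (by linarith) h3
    · filter_upwards [hsmall, self_mem_nhdsWithin] with η h1 h2
      have h2 : 0 < η := h2
      refine Eventually.of_forall fun s hs => ?_
      rw [uIoc_of_le ht.le] at hs
      by_cases hst : s ≤ t - η
      · rw [indicator_of_mem (show s ∈ {s | s ≤ t - η} from hst), Real.norm_eq_abs, abs_mul]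
        have hs0 := hs.1.le
        have := (convex_Icc s T).norm_image_sub_le_of_norm_hasDerivWithin_le
          (f := φ s) (f' := φ' s) (C := D) (fun τ hτ => hd s τ hs0 hτ.1 hτ.2)
          (fun τ hτ => hb s τ hs0 hτ.1 hτ.2) (x := t - η) (y := t) ⟨hst, by linarith⟩ ⟨hs.2, htT⟩
        rw [show t - (t - η) = η by ring, Real.norm_eq_abs, Real.norm_eq_abs, abs_of_pos h2] at this
        have h4 : |(φ s t - φ s (t - η)) / η| ≤ D := by
          rwa [abs_div, abs_of_pos h2, div_le_iff₀ h2]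
        calc _ ≤ 1 * D := mul_le_mul (hθ1 s) h4 (abs_nonneg _) zero_le_one
          _ = D := one_mul D
      · rw [indicator_of_notMem (show s ∉ {s | s ≤ t - η} from hst)]
        simpa using hD
    · exact intervalIntegrable_const
    · have hne : ∀ᵐ s : ℝ, s ≠ t := by simp [ae_iff, measure_singleton]
      filter_upwards [hne] with s hst hs
      rw [uIoc_of_le ht.le] at hs
      have hlt : s < t := lt_of_le_of_ne hs.2 hst
      have h1 := (hasDerivWithinAt_iff_tendsto_slope.1 (hd s t hs.1.le hs.2 htT))
      have h2 : Tendsto (fun η : ℝ => t - η) (𝓝[>] 0) (𝓝[Icc s T \ {t}] t) := by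
        apply tendsto_nhdsWithin_of_tendsto_nhds_of_eventually_within
        · have : Continuous (fun η : ℝ => t - η) := by fun_prop
          simpa using (this.tendsto 0).mono_left (nhdsWithin_le_nhds (s := Ioi 0))
        · have : ∀ᶠ η in 𝓝[>] (0:ℝ), η < t - s :=
            (eventually_lt_nhds (sub_pos.2 hlt)).filter_mono nhdsWithin_le_nhds
          filter_upwards [this, self_mem_nhdsWithin] with η h1 h2
          have h2 : 0 < η := h2
          refine ⟨⟨by linarith, by linarith⟩, ?_⟩
          simp only [mem_singleton_iff]; linarith
      refine ((h1.comp h2).const_mul (θ s)).congr' ?_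
      have : ∀ᶠ η in 𝓝[>] (0:ℝ), η < t - s :=
        (eventually_lt_nhds (sub_pos.2 hlt)).filter_mono nhdsWithin_le_nhds
      filter_upwards [this, self_mem_nhdsWithin] with η h1 h2
      have h2 : 0 < η := h2
      rw [indicator_of_mem (show s ∈ {s | s ≤ t - η} by change s ≤ t - η; linarith)]
      simp only [Function.comp, slope_def_field]
      congr 1
      rw [show t - η - t = -η by ring, div_neg, ← neg_div, neg_sub]
  set I := ∫ s in (0:ℝ)..t, θ s * φ' s t with hI
  set δ := (c - (γ + I)) / 2 with hδ
  have hδp : 0 < δ := by rw [hδ]; linarith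
  have e1 := hlim.eventually_le_const (show I < I + δ by linarith)
  obtain ⟨a, hat, ha⟩ := (mem_nhdsLT_iff_exists_Ioo_subset).1 (hγ δ hδp)
  have e2 : ∀ᶠ η in 𝓝[>] (0:ℝ), η < t - a :=
    (eventually_lt_nhds (sub_pos.2 hat)).filter_mono nhdsWithin_le_nhds
  filter_upwards [e1, e2, hsmall, self_mem_nhdsWithin] with η h1 h2 h3 h4
  have h4 : 0 < η := h4
  rw [intervalIntegral.integral_indicator ⟨by linarith, by linarith⟩] at h1
  have j1 := hii t ⟨ht.le, htT⟩ 0 (t - η) le_rfl (by linarith) (by linarith)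
  have j2 := hii t ⟨ht.le, htT⟩ (t - η) t (by linarith) (by linarith) le_rfl
  have j3 := hii (t - η) ⟨by linarith, by linarith⟩ 0 (t - η) le_rfl (by linarith) le_rfl
  have k1 : (∫ s in (0:ℝ)..(t - η), θ s * ((φ s t - φ s (t - η)) / η))
      = ((∫ s in (0:ℝ)..(t - η), θ s * φ s t) - ∫ s in (0:ℝ)..(t - η), θ s * φ s (t - η)) / η := by
    rw [← intervalIntegral.integral_sub j1 j3, ← intervalIntegral.integral_div]
    congr 1; ext s; ring
  rw [k1, div_le_iff₀ h4] at h1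
  have k2 : ∫ s in (t - η)..t, θ s * φ s t ≤ (γ + δ) * η := by
    calc _ ≤ ∫ s in (t - η)..t, (γ + δ) := by
          refine intervalIntegral.integral_mono_on_of_le_Ioo (by linarith) j2 intervalIntegrable_const ?_
          intro s hs
          exact ha ⟨by linarith [hs.1], hs.2⟩
      _ = _ := by rw [intervalIntegral.integral_const, smul_eq_mul]; ring
  rw [← intervalIntegral.integral_add_adjacent_intervals j1 j2]
  have : c = (γ + δ) + (I + δ) := by rw [hδ]; ring
  rw [this]
  linarith

lemma Lr_integral {E : Type*} [NormedAddCommGroup E] [NormedSpace ℝ E] {m : ℕ}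
    (b : E) (v : Fin m → E) (x : E) (r : ℝ) (F : ℝ → E → ℝ) {t : ℝ} 
    (hF : ∀ y, IntervalIntegrable (fun s => F s y) volume 0 t) :
    IntervalIntegrable (fun s => LrOp b v (F s) x r) volume 0 t ∧
    LrOp b v (fun y => ∫ s in (0:ℝ)..t, F s y) x r = ∫ s in (0:ℝ)..t, LrOp b v (F s) x r := by
  unfold LrOp
  have h1 : IntervalIntegrable (fun s => (F s (x + r ^ 2 • b) - F s x) / r ^ 2) volume 0 t :=
    ((hF _).sub (hF _)).div_const _
  have h2 : ∀ i, IntervalIntegrable (fun s => (F s (x + r • v i) + F s (x - r • v i) - 2 * F s x) / r ^ 2) volume 0 t :=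
    fun i => (((hF _).add (hF _)).sub ((hF _).const_mul 2)).div_const _
  have h3 : IntervalIntegrable (fun s => ∑ i, (F s (x + r • v i) + F s (x - r • v i) - 2 * F s x) / r ^ 2) volume 0 t := by
    simp only [intervalIntegrable_iff] at h2 ⊢
    exact integrable_finsetSum _ fun i _ => h2 i
  refine ⟨h1.add (h3.const_mul _), ?_⟩
  rw [intervalIntegral.integral_add h1 (h3.const_mul _), intervalIntegral.integral_const_mul,
    intervalIntegral.integral_finsetSum (fun i _ => h2 i)]
  congr 1
  · rw [intervalIntegral.integral_div, intervalIntegral.integral_sub (hF _) (hF _)]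
  · congr 1
    refine Finset.sum_congr rfl fun i _ => ?_
    rw [intervalIntegral.integral_div, intervalIntegral.integral_sub ((hF _).add (hF _)) ((hF _).const_mul 2),
      intervalIntegral.integral_add (hF _) (hF _), intervalIntegral.integral_const_mul]

end cth

section core
variable {d m : ℕ}

noncomputable def drift (X : Fin (m + 1) → (Fin d → ℝ) → Fin d → ℝ) (x : Fin d → ℝ) : Fin d → ℝ :=
  X 0 x + (1 / 2 : ℝ) • ∑ i : Fin m, fderiv ℝ (X i.succ) x (X i.succ x)

lemma hormanderL_eq (X : Fin (m + 1) → (Fin d → ℝ) → Fin d → ℝ) (f : (Fin d → ℝ) → ℝ)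
    (x : Fin d → ℝ) : hormanderL X f x = fderiv ℝ f x (drift X x)
      + (1/2) * ∑ i : Fin m, fderiv ℝ (fun y => fderiv ℝ f y (X i.succ x)) x (X i.succ x) := by
  simp only [hormanderL, drift, map_add, map_smul, map_sum, smul_eq_mul]

lemma slice_smooth {A : ℝ → (Fin d → ℝ) → ℝ} {S : Set ℝ}
    (h : ContDiffOn ℝ (⊤ : ℕ∞) (fun p : ℝ × (Fin d → ℝ) => A p.1 p.2) (S ×ˢ univ)) {t : ℝ}
    (ht : t ∈ S) : ContDiff ℝ 2 (A t) := by
  have h2 := contDiffOn_infty.1 h 2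
  have h3 : ContDiff ℝ 2 (fun x : Fin d → ℝ => (t, x)) := contDiff_const.prodMk contDiff_id
  rw [← contDiffOn_univ]
  exact h2.comp h3.contDiffOn (fun x _ => ⟨ht, mem_univ _⟩)

lemma left_quot {f : ℝ → ℝ} {f' T t : ℝ} (ht : 0 < t) (htT : t ≤ T)
    (h : HasDerivWithinAt f f' (Icc 0 T) t) :
    Tendsto (fun η => (f t - f (t - η)) / η) (𝓝[>] 0) (𝓝 f') := by
  have h1 := hasDerivWithinAt_iff_tendsto_slope.1 h
  have h2 : Tendsto (fun η : ℝ => t - η) (𝓝[>] 0) (𝓝[Icc 0 T \ {t}] t) := by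
    apply tendsto_nhdsWithin_of_tendsto_nhds_of_eventually_within
    · have : Continuous (fun η : ℝ => t - η) := by fun_prop
      simpa using (this.tendsto 0).mono_left (nhdsWithin_le_nhds (s := Ioi 0))
    · have : ∀ᶠ η in 𝓝[>] (0:ℝ), η < t :=
        (eventually_lt_nhds ht).filter_mono nhdsWithin_le_nhds
      filter_upwards [this, self_mem_nhdsWithin] with η h1 h2
      have h2 : 0 < η := h2
      refine ⟨⟨by linarith, by linarith⟩, ?_⟩
      simp only [mem_singleton_iff]; linarith
  refine (h1.comp h2).congr fun η => ?_
  simp only [Function.comp, slope_def_field]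
  rw [show t - η - t = -η by ring, div_neg, ← neg_div, neg_sub]

lemma lin_growth {E : Type*} [NormedAddCommGroup E] [NormedSpace ℝ E] {X : E → E}
    (hX : Differentiable ℝ X) {C : ℝ} (hC : ∀ x, ‖fderiv ℝ X x‖ ≤ C) :
    ∃ K, 0 ≤ K ∧ ∀ x, ‖X x‖ ≤ K * (1 + ‖x‖) := by
  have hC0 : 0 ≤ C := (norm_nonneg _).trans (hC 0)
  refine ⟨‖X 0‖ + C, by positivity, fun x => ?_⟩
  have h := convex_univ.norm_image_sub_le_of_norm_fderiv_le (𝕜 := ℝ) (f := X) (C := C) (x := 0) (y := x)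
    (fun y _ => hX y) (fun y _ => hC y) (mem_univ _) (mem_univ _)
  rw [sub_zero] at h
  have h2 : ‖X x‖ ≤ ‖X x - X 0‖ + ‖X 0‖ := by
    simpa using norm_add_le (X x - X 0) (X 0)
  nlinarith [norm_nonneg x, norm_nonneg (X 0)]

lemma growth (X : Fin (m + 1) → (Fin d → ℝ) → Fin d → ℝ)
    (hXsmooth : ∀ i, ContDiff ℝ (⊤ : ℕ∞) (X i)) (hXbdd : ∀ i, BoundedDerivs (X i)) :
    ∃ K : ℝ, (∀ x, ‖drift X x‖ ≤ K * (1 + ‖x‖)) ∧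
      ∀ x (i : Fin m), ‖X i.succ x‖ ≤ K * (1 + ‖x‖) := by
  have hd : ∀ i, ∃ C, ∀ x, ‖fderiv ℝ (X i) x‖ ≤ C := fun i => by
    obtain ⟨C, hC⟩ := hXbdd i 1 le_rfl
    exact ⟨C, fun x => by rw [← norm_iteratedFDeriv_one]; exact hC x⟩
  choose C hC using hd
  have hdiff : ∀ i, Differentiable ℝ (X i) := fun i => (hXsmooth i).differentiable (by simp)
  choose K hK0 hK using fun i => lin_growth (hdiff i) (hC i)
  have hC0 : ∀ i, 0 ≤ C i := fun i => (norm_nonneg _).trans (hC i 0)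
  refine ⟨∑ i, K i + ∑ i : Fin m, C i.succ * K i.succ, fun x => ?_, fun x i => ?_⟩
  · have h0 : ‖X 0 x‖ ≤ (∑ i, K i) * (1 + ‖x‖) := by
      refine (hK 0 x).trans ?_
      have := Finset.single_le_sum (f := K) (fun i _ => hK0 i) (Finset.mem_univ 0)
      gcongr
    have h1 : ‖∑ i : Fin m, fderiv ℝ (X i.succ) x (X i.succ x)‖ ≤
        (∑ i : Fin m, C i.succ * K i.succ) * (1 + ‖x‖) := by
      rw [Finset.sum_mul]
      refine norm_sum_le_of_le _ fun i _ => (ContinuousLinearMap.le_opNorm _ _).trans ?_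
      rw [mul_assoc]
      exact mul_le_mul (hC _ x) (hK _ x) (norm_nonneg _) (hC0 _)
    have h2 : ‖drift X x‖ ≤ ‖X 0 x‖ + (1/2) * ‖∑ i : Fin m, fderiv ℝ (X i.succ) x (X i.succ x)‖ := by
      unfold drift
      refine (norm_add_le _ _).trans ?_
      rw [norm_smul]; norm_num
    have h3 := norm_nonneg (∑ i : Fin m, fderiv ℝ (X i.succ) x (X i.succ x))
    rw [add_mul]; linarith
  · refine (hK _ x).trans ?_
    have h1 := Finset.single_le_sum (f := K) (fun i _ => hK0 i) (Finset.mem_univ i.succ)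
    have h2 : 0 ≤ ∑ i : Fin m, C i.succ * K i.succ :=
      Finset.sum_nonneg fun i _ => mul_nonneg (hC0 _) (hK0 _)
    gcongr; linarith

lemma Cth_cont {T : ℝ} (hT : 0 < T) {Φ : ℝ → ℝ → (Fin d → ℝ) → ℝ}
    (hΦcont : ContinuousOn (fun p : (ℝ × ℝ) × (Fin d → ℝ) => Φ p.1.1 p.1.2 p.2)
      (simplexST T ×ˢ Set.univ))
    (hΦloc : ∀ K : Set (Fin d → ℝ), IsCompact K → ∃ C : ℝ,
      ∀ q ∈ simplexST T, ∀ x ∈ K, |Φ q.1 q.2 x| ≤ C)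
    (hsl : ∀ x, ∀ t ∈ Icc 0 T, ContinuousOn (fun s => Φ s t x) (Icc 0 t))
    {θ : ℝ → ℝ} (hθ : Measurable θ) (hθ1 : ∀ s, |θ s| ≤ 1) :
    ContinuousOn (fun p : ℝ × (Fin d → ℝ) => ∫ s in (0:ℝ)..p.1, θ s * Φ s p.1 p.2)
      (Icc 0 T ×ˢ univ) := by
  rintro ⟨t0, x0⟩ ⟨ht0, -⟩
  have ht0 : t0 ∈ Icc 0 T := ht0
  have key : ContinuousWithinAt (fun p : ℝ × (Fin d → ℝ) => ∫ s in (0:ℝ)..T,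
      {s | s ≤ p.1}.indicator (fun s => θ s * Φ s p.1 p.2) s) (Icc 0 T ×ˢ univ) (t0, x0) := by
    obtain ⟨C, hC⟩ := hΦloc (Metric.closedBall x0 1) (isCompact_closedBall _ _)
    refine intervalIntegral.continuousWithinAt_of_dominated_interval (bound := fun _ => max C 0) ?_ ?_ ?_ ?_
    · filter_upwards [self_mem_nhdsWithin] with p hp
      exact ind_meas hp.1.1 hp.1.2 (th_int hθ hθ1 (ii_of (hsl p.2 p.1 hp.1) le_rfl hp.1.1 le_rfl))
    · have hball : ∀ᶠ p : ℝ × (Fin d → ℝ) in 𝓝[Icc 0 T ×ˢ univ] (t0, x0), p.2 ∈ Metric.closedBall x0 1 := by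
        refine Filter.Eventually.filter_mono nhdsWithin_le_nhds ?_
        exact (continuous_snd.tendsto (t0, x0)).eventually (Metric.closedBall_mem_nhds x0 one_pos)
      filter_upwards [self_mem_nhdsWithin, hball] with p hp hpb
      refine Eventually.of_forall fun s hs => ?_
      rw [uIoc_of_le hT.le] at hs
      by_cases hst : s ≤ p.1
      · rw [indicator_of_mem (show s ∈ {s | s ≤ p.1} from hst), Real.norm_eq_abs, abs_mul]
        have := hC (s, p.1) ⟨hs.1.le, hst, hp.1.2⟩ p.2 hpb
        calc _ ≤ 1 * C := mul_le_mul (hθ1 s) this (abs_nonneg _) zero_le_one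
          _ ≤ _ := by rw [one_mul]; exact le_max_left _ _
      · rw [indicator_of_notMem (show s ∉ {s | s ≤ p.1} from hst)]
        simp
    · exact intervalIntegrable_const
    · have hne : ∀ᵐ s : ℝ, s ≠ t0 := by simp [ae_iff, measure_singleton]
      filter_upwards [hne] with s hst hs
      rw [uIoc_of_le hT.le] at hs
      have hfst : Tendsto (fun p : ℝ × (Fin d → ℝ) => p.1) (𝓝[Icc 0 T ×ˢ univ] (t0, x0)) (𝓝 t0) :=
        (continuous_fst.tendsto (t0, x0)).mono_left nhdsWithin_le_nhds
      rcases lt_or_gt_of_ne hst with hlt | hgt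
      · have ev : ∀ᶠ p : ℝ × (Fin d → ℝ) in 𝓝[Icc 0 T ×ˢ univ] (t0, x0), s < p.1 :=
          hfst.eventually_const_lt hlt
        have h1 := hΦcont ((s, t0), x0) ⟨⟨hs.1.le, hlt.le, ht0.2⟩, mem_univ _⟩
        have h2 : Tendsto (fun p : ℝ × (Fin d → ℝ) => ((s, p.1), p.2)) (𝓝[Icc 0 T ×ˢ univ] (t0, x0))
            (𝓝[simplexST T ×ˢ univ] ((s, t0), x0)) := by
          apply tendsto_nhdsWithin_of_tendsto_nhds_of_eventually_within
          · have : Continuous (fun p : ℝ × (Fin d → ℝ) => ((s, p.1), p.2)) := by fun_prop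
            exact (this.tendsto (t0, x0)).mono_left nhdsWithin_le_nhds
          · filter_upwards [ev, self_mem_nhdsWithin] with p hp hp2
            exact ⟨⟨hs.1.le, hp.le, hp2.1.2⟩, mem_univ _⟩
        have h3 : Tendsto _ _ _ := (Tendsto.comp h1 h2).const_mul (θ s)
        change Tendsto _ _ (𝓝 ({s | s ≤ t0}.indicator (fun s => θ s * Φ s t0 x0) s))
        rw [indicator_of_mem (show s ∈ {s | s ≤ t0} from hlt.le)]
        refine h3.congr' ?_
        filter_upwards [ev] with p hp
        rw [indicator_of_mem (show s ∈ {s | s ≤ p.1} from hp.le)]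
        rfl
      · have ev : ∀ᶠ p : ℝ × (Fin d → ℝ) in 𝓝[Icc 0 T ×ˢ univ] (t0, x0), p.1 < s :=
          hfst.eventually_lt_const hgt
        change Tendsto _ _ (𝓝 ({s | s ≤ t0}.indicator (fun s => θ s * Φ s t0 x0) s))
        rw [indicator_of_notMem (show s ∉ {s | s ≤ t0} from not_le.2 hgt)]
        refine tendsto_const_nhds.congr' ?_
        filter_upwards [ev] with p hp
        rw [indicator_of_notMem (show s ∉ {s | s ≤ p.1} from not_le.2 hp)]
  refine key.congr (fun p hp => ?_) ?_
  · rw [intervalIntegral.integral_indicator hp.1]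
  · rw [intervalIntegral.integral_indicator (show ((t0, x0) : ℝ × (Fin d → ℝ)).1 ∈ _ from ht0)]

lemma Cth_Lr {T : ℝ} {Φ : ℝ → ℝ → (Fin d → ℝ) → ℝ}
    (hsm : ∀ s t, 0 ≤ s → s ≤ t → t ≤ T → ContDiff ℝ 2 (Φ s t))
    (hΦloc : ∀ K : Set (Fin d → ℝ), IsCompact K → ∃ C : ℝ,
      ∀ q ∈ simplexST T, ∀ x ∈ K, ∀ k : ℕ, k ≤ 2 → ‖iteratedFDeriv ℝ k (Φ q.1 q.2) x‖ ≤ C)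
    (hsl : ∀ x, ∀ t ∈ Icc 0 T, ContinuousOn (fun s => Φ s t x) (Icc 0 t))
    {θ : ℝ → ℝ} (hθ : Measurable θ) (hθ1 : ∀ s, |θ s| ≤ 1) {t : ℝ} (ht : t ∈ Icc 0 T)
    (x b : Fin d → ℝ) (v : Fin m → Fin d → ℝ) :
    Tendsto (LrOp b v (fun y => ∫ s in (0:ℝ)..t, θ s * Φ s t y) x) (𝓝[>] 0)
      (𝓝 (∫ s in (0:ℝ)..t, θ s * (fderiv ℝ (Φ s t) x b
        + (1/2) * ∑ i, fderiv ℝ (fun y => fderiv ℝ (Φ s t) y (v i)) x (v i)))) := by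
  have hii : ∀ y, IntervalIntegrable (fun s => Φ s t y) volume 0 t :=
    fun y => ii_of (hsl y t ht) le_rfl ht.1 le_rfl
  have hLθ : ∀ s r, LrOp b v (fun y => θ s * Φ s t y) x r = θ s * LrOp b v (Φ s t) x r := by
    intro s r
    have := LrOp_sub_mul b v (fun _ => 0) (Φ s t) (θ s) x r
    simp only [zero_add] at this
    rw [this]; simp [LrOp]
  have e : ∀ r, LrOp b v (fun y => ∫ s in (0:ℝ)..t, θ s * Φ s t y) x r
      = ∫ s in (0:ℝ)..t, θ s * LrOp b v (Φ s t) x r := by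
    intro r
    rw [(Lr_integral b v x r (fun s y => θ s * Φ s t y) (fun y => th_int hθ hθ1 (hii y))).2]
    simp only [hLθ]
  rw [show LrOp b v (fun y => ∫ s in (0:ℝ)..t, θ s * Φ s t y) x = _ from funext e]
  obtain ⟨R, hR⟩ := LrOp_bound x b v
  obtain ⟨C, hC⟩ := hΦloc (Metric.closedBall x R) (isCompact_closedBall _ _)
  obtain ⟨D, hD⟩ := hR C
  refine intervalIntegral.tendsto_integral_filter_of_dominated_convergence (fun _ => D) ?_ ?_ ?_ ?_
  · refine Eventually.of_forall fun r => ?_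
    have := th_int hθ hθ1 (Lr_integral b v x r (fun s y => Φ s t y) hii).1
    rw [intervalIntegrable_iff] at this
    exact this.aestronglyMeasurable
  · have : ∀ᶠ r in 𝓝[>] (0:ℝ), r < 1 := (eventually_lt_nhds one_pos).filter_mono nhdsWithin_le_nhds
    filter_upwards [this, self_mem_nhdsWithin] with r hr1 hr0
    refine Eventually.of_forall fun s hs => ?_
    rw [uIoc_of_le ht.1] at hs
    have h1 := hD (Φ s t) (hsm s t hs.1.le hs.2 ht.2)
      (fun y hy => by
        rw [← norm_iteratedFDeriv_one]
        exact hC (s, t) ⟨hs.1.le, hs.2, ht.2⟩ y hy 1 (by norm_num))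
      (fun y hy => hC (s, t) ⟨hs.1.le, hs.2, ht.2⟩ y hy 2 le_rfl) r hr0 hr1.le
    rw [Real.norm_eq_abs, abs_mul]
    calc _ ≤ 1 * D := mul_le_mul (hθ1 s) h1 (abs_nonneg _) zero_le_one
      _ = D := one_mul D
  · exact intervalIntegrable_const
  · refine Eventually.of_forall fun s hs => ?_
    rw [uIoc_of_le ht.1] at hs
    exact (LrOp_tendsto (hsm s t hs.1.le hs.2 ht.2) x b v).const_mul _

end core

section fin
variable {d m : ℕ}

lemma LrOp_E1 (X : Fin (m + 1) → (Fin d → ℝ) → Fin d → ℝ) {f : (Fin d → ℝ) → ℝ}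
    (hf : ContDiff ℝ 2 f) (c : ℝ) (x : Fin d → ℝ) :
    Tendsto (LrOp (drift X x) (fun i : Fin m => X i.succ x) (fun y => f y ^ 2 + c) x) (𝓝[>] 0)
      (𝓝 (2 * f x * hormanderL X f x + ∑ i : Fin m, fderiv ℝ f x (X i.succ x) ^ 2)) := by
  have hd : Differentiable ℝ f := hf.differentiable (by norm_num)
  have h2 : ContDiff ℝ 2 (fun y => f y ^ 2 + c) := (hf.pow 2).add contDiff_const
  have h := LrOp_tendsto h2 x (drift X x) (fun i : Fin m => X i.succ x)
  have e1 : ∀ y w, fderiv ℝ (fun y => f y ^ 2 + c) y w = 2 * f y * fderiv ℝ f y w := by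
    intro y w
    have : HasFDerivAt (fun y => f y ^ 2 + c) ((2 * f y) • fderiv ℝ f y) y := by
      have := ((hd y).hasFDerivAt.pow 2).add_const c
      simpa using this
    rw [this.fderiv]; simp
  have e2 : ∀ w, fderiv ℝ (fun y => fderiv ℝ (fun y => f y ^ 2 + c) y w) x w
      = 2 * fderiv ℝ f x w ^ 2 + 2 * f x * fderiv ℝ (fun y => fderiv ℝ f y w) x w := by
    intro w
    have h3 := (fd_fd hf w x).hasFDerivAt
    have : HasFDerivAt (fun y => fderiv ℝ (fun y => f y ^ 2 + c) y w)
        ((2 * f x) • fderiv ℝ (fun y => fderiv ℝ f y w) x + (fderiv ℝ f x w) • ((2:ℝ) • fderiv ℝ f x)) x := by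
      simp only [e1]
      exact ((hd x).hasFDerivAt.const_mul 2).mul h3
    rw [this.fderiv]; simp; ring
  refine h.trans_eq ?_
  simp only [e2]; simp only [e1]
  rw [hormanderL_eq, Finset.sum_add_distrib, ← Finset.mul_sum, ← Finset.mul_sum]
  congr 1; ring

lemma barLh_eq (X : Fin (m + 1) → (Fin d → ℝ) → Fin d → ℝ) (h : Fin m → ℝ → ℝ) (t : ℝ)
    {a b : (Fin d → ℝ) → ℝ} (ha : ContDiff ℝ 2 a) (hb : ContDiff ℝ 2 b) (x : Fin d → ℝ) :
    barLh X h t (fun p => a p.1 * p.2 + b p.1) (x, 0)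
      = hormanderL X b x + ∑ i : Fin m, h i t * fderiv ℝ a x (X i.succ x) := by
  have hda : Differentiable ℝ a := ha.differentiable (by norm_num)
  have hdb : Differentiable ℝ b := hb.differentiable (by norm_num)
  have fst : ∀ {g : (Fin d → ℝ) → ℝ}, Differentiable ℝ g → ∀ p : (Fin d → ℝ) × ℝ,
      HasFDerivAt (fun q : (Fin d → ℝ) × ℝ => g q.1)
        ((fderiv ℝ g p.1).comp (ContinuousLinearMap.fst ℝ _ _)) p := fun hg p =>
    (hg p.1).hasFDerivAt.comp p hasFDerivAt_fst
  have e1 : ∀ (p : (Fin d → ℝ) × ℝ) (w : Fin d → ℝ) (c : ℝ),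
      fderiv ℝ (fun p : (Fin d → ℝ) × ℝ => a p.1 * p.2 + b p.1) p (w, c)
      = (a p.1 * c + p.2 * fderiv ℝ a p.1 w) + fderiv ℝ b p.1 w := by
    intro p w c
    have := ((fst hda p).mul (hasFDerivAt_snd (𝕜 := ℝ) (p := p))).add (fst hdb p)
    erw [this.fderiv]; simp
  have e2 : ∀ (w : Fin d → ℝ) (c : ℝ),
      fderiv ℝ (fun q => fderiv ℝ (fun p : (Fin d → ℝ) × ℝ => a p.1 * p.2 + b p.1) q (w, c)) (x, 0) (w, c)
      = 2 * (c * fderiv ℝ a x w) + fderiv ℝ (fun y => fderiv ℝ b y w) x w := by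
    intro w c
    simp only [e1]
    have := (((fst hda (x, 0)).mul_const c).add
      ((hasFDerivAt_snd (𝕜 := ℝ) (p := ((x, 0) : (Fin d → ℝ) × ℝ))).mul (fst (fd_fd ha w) (x, 0)))).add
      (fst (fd_fd hb w) (x, 0))
    erw [this.fderiv]; simp; ring
  unfold barLh hormanderL
  simp only [e2]; simp only [e1]
  simp only [mul_zero, zero_mul, zero_add, Finset.sum_add_distrib, ← Finset.mul_sum]
  ring

end fin

/-- Theorem 2.2 (Elementary integration by parts formula):
`∫₀ᵗ P_{t-s}[∑ᵢ hⁱ(s) Xᵢ P_s f](x) ds = P̄ʰ_t[u f](x,0)`, i.e.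
`B(t,x) = ∫₀ᵗ Φ(s,t,x) ds` where `G(t,x,u) = A(t,x)·u + B(t,x)` solves the `L̄^h` equation. -/
theorem elementary_integration_by_parts (d m : ℕ) (hd : 0 < d) (hm : 0 < m)
    (X : Fin (m + 1) → (Fin d → ℝ) → Fin d → ℝ)
    (hXsmooth : ∀ i, ContDiff ℝ (⊤ : ℕ∞) (X i)) (hXbdd : ∀ i, BoundedDerivs (X i))
    (h : Fin m → ℝ → ℝ) (hhsmooth : ∀ i, ContDiff ℝ (⊤ : ℕ∞) (h i))
    (hhbdd : ∀ i, ∃ C : ℝ, ∀ t, |h i t| ≤ C)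
    (T : ℝ) (hT : 0 < T)
    (f : (Fin d → ℝ) → ℝ) (hfsmooth : ContDiff ℝ (⊤ : ℕ∞) f) (hfbdd : ∃ C : ℝ, ∀ x, |f x| ≤ C)
    -- (i) `A` is a bounded smooth solution of `∂ₜA = LA`, `A(0,·) = f`
    (A : ℝ → (Fin d → ℝ) → ℝ)
    (hAbdd : ∃ C : ℝ, ∀ t ∈ Set.Icc (0 : ℝ) T, ∀ x, |A t x| ≤ C)
    (hAsmooth : ContDiffOn ℝ (⊤ : ℕ∞) (fun p : ℝ × (Fin d → ℝ) => A p.1 p.2)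
      (Set.Icc (0 : ℝ) T ×ˢ Set.univ))
    (hApde : ∀ t ∈ Set.Icc (0 : ℝ) T, ∀ x,
      HasDerivWithinAt (fun s => A s x) (hormanderL X (A t) x) (Set.Icc (0 : ℝ) T) t)
    (hA0 : ∀ x, A 0 x = f x)
    -- (ii) `B` is bounded smooth with `B(0,·) = 0` and `G(t,x,u) = A(t,x)·u + B(t,x)`
    -- satisfies `∂ₜG = L̄^h_t G`
    (B : ℝ → (Fin d → ℝ) → ℝ)
    (hBbdd : ∃ C : ℝ, ∀ t ∈ Set.Icc (0 : ℝ) T, ∀ x, |B t x| ≤ C)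
    (hBsmooth : ContDiffOn ℝ (⊤ : ℕ∞) (fun p : ℝ × (Fin d → ℝ) => B p.1 p.2)
      (Set.Icc (0 : ℝ) T ×ˢ Set.univ))
    (hB0 : ∀ x, B 0 x = 0)
    (hGpde : ∀ t ∈ Set.Icc (0 : ℝ) T, ∀ (x : Fin d → ℝ) (u : ℝ),
      HasDerivWithinAt (fun s => A s x * u + B s x)
        (barLh X h t (fun p => A t p.1 * p.2 + B t p.1) (x, u)) (Set.Icc (0 : ℝ) T) t)
    -- (iii) `Φ(s,t,x)`: for each `s`, `(t,x) ↦ Φ(s,t,x)` is smooth, bounded, solves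
    -- `∂ₜΦ = LΦ` with `Φ(s,s,x) = ∑ᵢ hⁱ(s)⟨Xᵢ(x), ∇ₓA(s,x)⟩`, with `Φ`, `∂ₜΦ` and the
    -- spatial derivatives up to order two continuous in `(s,t,x)` and locally bounded
    (Φ Φ' : ℝ → ℝ → (Fin d → ℝ) → ℝ)
    (hΦsmooth : ∀ s ∈ Set.Icc (0 : ℝ) T,
      ContDiffOn ℝ (⊤ : ℕ∞) (fun p : ℝ × (Fin d → ℝ) => Φ s p.1 p.2) (Set.Icc s T ×ˢ Set.univ))
    (hΦbdd0 : ∀ s ∈ Set.Icc (0 : ℝ) T, ∃ C : ℝ, ∀ t ∈ Set.Icc s T, ∀ x, |Φ s t x| ≤ C)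
    (hΦderiv : ∀ s t : ℝ, 0 ≤ s → s ≤ t → t ≤ T → ∀ x,
      HasDerivWithinAt (fun τ => Φ s τ x) (Φ' s t x) (Set.Icc s T) t)
    (hΦpde : ∀ s t : ℝ, 0 ≤ s → s ≤ t → t ≤ T → ∀ x, Φ' s t x = hormanderL X (Φ s t) x)
    (hΦinit : ∀ s ∈ Set.Icc (0 : ℝ) T, ∀ x,
      Φ s s x = ∑ i : Fin m, h i s * fderiv ℝ (A s) x (X i.succ x))
    (hΦcont : ContinuousOn (fun p : (ℝ × ℝ) × (Fin d → ℝ) => Φ p.1.1 p.1.2 p.2)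
      (simplexST T ×ˢ Set.univ))
    (hΦ'cont : ContinuousOn (fun p : (ℝ × ℝ) × (Fin d → ℝ) => Φ' p.1.1 p.1.2 p.2)
      (simplexST T ×ˢ Set.univ))
    (hΦDcont : ∀ k : ℕ, k ≤ 2 →
      ContinuousOn (fun p : (ℝ × ℝ) × (Fin d → ℝ) => iteratedFDeriv ℝ k (Φ p.1.1 p.1.2) p.2)
        (simplexST T ×ˢ Set.univ))
    (hΦloc : ∀ K : Set (Fin d → ℝ), IsCompact K → ∃ C : ℝ,
      ∀ q ∈ simplexST T, ∀ x ∈ K,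
        |Φ q.1 q.2 x| ≤ C ∧ |Φ' q.1 q.2 x| ≤ C ∧
        ∀ k : ℕ, k ≤ 2 → ‖iteratedFDeriv ℝ k (Φ q.1 q.2) x‖ ≤ C)
    -- (iv) uniqueness of bounded smooth solutions of the inhomogeneous equation with
    -- zero initial condition
    (huniq : ∀ C₁ C₂ : ℝ → (Fin d → ℝ) → ℝ,
      IsBddSolInhom X h T A C₁ → IsBddSolInhom X h T A C₂ →
      (∀ x, C₁ 0 x = 0) → (∀ x, C₂ 0 x = 0) →
      ∀ t ∈ Set.Icc (0 : ℝ) T, C₁ t = C₂ t) :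
    ∀ t ∈ Set.Icc (0 : ℝ) T, ∀ x, B t x = ∫ s in (0 : ℝ)..t, Φ s t x := by
  have hTm : ∀ t, 0 < t → t ≤ T → t ∈ Icc (0:ℝ) T := fun t h1 h2 => ⟨h1.le, h2⟩
  have hAs : ∀ t ∈ Icc (0:ℝ) T, ContDiff ℝ 2 (A t) := fun t ht => slice_smooth hAsmooth ht
  have hBs : ∀ t ∈ Icc (0:ℝ) T, ContDiff ℝ 2 (B t) := fun t ht => slice_smooth hBsmooth ht
  have hΦs : ∀ s t, 0 ≤ s → s ≤ t → t ≤ T → ContDiff ℝ 2 (Φ s t) := fun s t h1 h2 h3 =>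
    slice_smooth (hΦsmooth s ⟨h1, h2.trans h3⟩) ⟨h2, h3⟩
  have hsl : ∀ x, ∀ t ∈ Icc 0 T, ContinuousOn (fun s => Φ s t x) (Icc 0 t) := by
    intro x t ht
    have hc : Continuous (fun s : ℝ => ((s, t), x)) := by fun_prop
    exact hΦcont.comp hc.continuousOn (fun s hs => ⟨⟨hs.1, hs.2, ht.2⟩, mem_univ _⟩)
  obtain ⟨Kg, hKb, hKv⟩ := growth X hXsmooth hXbdd
  set g : ℝ → (Fin d → ℝ) → ℝ := fun t x => ∑ i : Fin m, h i t * fderiv ℝ (A t) x (X i.succ x) with hg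
  -- the comparison principle for `C_θ + E`
  have core : ∀ (θ : ℝ → ℝ), Measurable θ → (∀ s, |θ s| ≤ 1) → ∀ (E : ℝ → (Fin d → ℝ) → ℝ),
      ContinuousOn (fun p : ℝ × (Fin d → ℝ) => E p.1 p.2) (Icc 0 T ×ˢ univ) →
      (∀ x, E 0 x ≤ 0) →
      (∃ M, ∀ t ∈ Icc 0 T, ∀ x, (∫ s in (0:ℝ)..t, θ s * Φ s t x) + E t x ≤ M) →
      (∀ t, 0 < t → t ≤ T → ∀ x, ∃ e E' γ,
        Tendsto (LrOp (drift X x) (fun i : Fin m => X i.succ x) (E t) x) (𝓝[>] 0) (𝓝 e) ∧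
        HasDerivWithinAt (fun s => E s x) E' (Icc 0 T) t ∧
        (∀ δ > 0, ∀ᶠ s in 𝓝[<] t, θ s * Φ s t x ≤ γ + δ) ∧ γ + E' ≤ e) →
      ∀ t ∈ Icc 0 T, ∀ x, (∫ s in (0:ℝ)..t, θ s * Φ s t x) + E t x ≤ 0 := by
    intro θ hθ hθ1 E hEc hE0 ⟨M, hM⟩ hE
    refine max_principle hT (drift X) (fun x i => X i.succ x) hKb hKv
      (fun t x => (∫ s in (0:ℝ)..t, θ s * Φ s t x) + E t x) ?_ hM ?_ ?_
    · refine (Cth_cont hT hΦcont ?_ hsl hθ hθ1).add hEc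
      intro K hK
      obtain ⟨C, hC⟩ := hΦloc K hK
      exact ⟨C, fun q hq x hx => (hC q hq x hx).1⟩
    · intro x; simpa using hE0 x
    · intro t ht htT x
      obtain ⟨e, E', γ, h1, h2, h3, h4⟩ := hE t ht htT x
      have l1 := Cth_Lr (m := m) hΦs (fun K hK => by
        obtain ⟨C, hC⟩ := hΦloc K hK
        exact ⟨C, fun q hq x hx => (hC q hq x hx).2.2⟩) hsl hθ hθ1 (hTm t ht htT) x (drift X x)
        (fun i : Fin m => X i.succ x)
      have hint : (∫ s in (0:ℝ)..t, θ s * (fderiv ℝ (Φ s t) x (drift X x)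
          + (1/2) * ∑ i : Fin m, fderiv ℝ (fun y => fderiv ℝ (Φ s t) y (X i.succ x)) x (X i.succ x)))
          = ∫ s in (0:ℝ)..t, θ s * Φ' s t x := by
        refine intervalIntegral.integral_congr fun s hs => ?_
        rw [uIcc_of_le ht.le] at hs
        rw [hΦpde s t hs.1 hs.2 htT x, hormanderL_eq]
      rw [hint] at l1
      refine ⟨(∫ s in (0:ℝ)..t, θ s * Φ' s t x) + e, ?_, ?_⟩
      · refine (l1.add h1).congr fun r => ?_
        have := LrOp_sub_mul (drift X x) (fun i : Fin m => X i.succ x)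
          (fun y => ∫ s in (0:ℝ)..t, θ s * Φ s t y) (E t) 1 x r
        simp only [one_mul] at this
        exact this.symm
      · intro c hc
        obtain ⟨D, hD⟩ := hΦloc {x} isCompact_singleton
        set δ := (c - ((∫ s in (0:ℝ)..t, θ s * Φ' s t x) + e)) / 2 with hδ
        have hδp : 0 < δ := by rw [hδ]; linarith
        have a1 := left_incr (fun s t => Φ s t x) (fun s t => Φ' s t x) ht htT (D := D)
          (fun s τ q1 q2 q3 => hΦderiv s τ q1 q2 q3 x)
          (fun s τ q1 q2 q3 => (hD (s, τ) ⟨q1, q2, q3⟩ x rfl).2.1) (hsl x) hθ hθ1 h3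
          (γ + (∫ s in (0:ℝ)..t, θ s * Φ' s t x) + δ) (by linarith)
        have a2 := (left_quot ht htT h2).eventually_le_const (show E' < E' + δ by linarith)
        filter_upwards [a1, a2, self_mem_nhdsWithin] with η b1 b2 b3
        have b3 : 0 < η := b3
        rw [div_le_iff₀ b3] at b2
        have : γ + (∫ s in (0:ℝ)..t, θ s * Φ' s t x) + δ + (E' + δ) ≤ c := by
          have : c = (∫ s in (0:ℝ)..t, θ s * Φ' s t x) + e + 2 * δ := by rw [hδ]; ring
          linarith
        have := mul_le_mul_of_nonneg_right this b3.le
        linarith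
  -- limits at the diagonal
  have hdiag : ∀ t, 0 < t → t ≤ T → ∀ x, Tendsto (fun s => Φ s t x) (𝓝[<] t) (𝓝 (g t x)) := by
    intro t ht htT x
    have h1 := hsl x t ⟨ht.le, htT⟩ t ⟨ht.le, le_rfl⟩
    rw [ContinuousWithinAt, hΦinit t ⟨ht.le, htT⟩ x] at h1
    refine h1.mono_left ?_
    refine nhdsWithin_le_of_mem ?_
    filter_upwards [Ioo_mem_nhdsLT ht] with s hs
    exact ⟨hs.1.le, hs.2.le⟩
  -- Step 1: `C` is bounded
  obtain ⟨a, ha⟩ := hAbdd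
  have hh : ∃ K : ℝ, 0 ≤ K ∧ ∀ t x, |g t x| ≤ K + ∑ i : Fin m, fderiv ℝ (A t) x (X i.succ x) ^ 2 := by
    choose Ch hCh using hhbdd
    refine ⟨∑ i, Ch i ^ 2, by positivity, fun t x => ?_⟩
    rw [hg, ← Finset.sum_add_distrib]
    refine (Finset.abs_sum_le_sum_abs _ _).trans (Finset.sum_le_sum fun i _ => ?_)
    rw [abs_mul]
    have h1 := hCh i t
    have h2 := abs_nonneg (h i t)
    rw [← sq_abs (fderiv ℝ (A t) x (X i.succ x))]
    have h3 := abs_nonneg (fderiv ℝ (A t) x (X i.succ x))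
    nlinarith [sq_nonneg (Ch i - |fderiv ℝ (A t) x (X i.succ x)|), mul_le_mul_of_nonneg_right h1 h3,
      sq_nonneg (Ch i), sq_nonneg (|fderiv ℝ (A t) x (X i.succ x)|)]
  obtain ⟨K, hK0, hK⟩ := hh
  set F : ℕ → Set ℝ := fun k => {s | s ∈ Icc (0:ℝ) T ∧ ∀ t, s ≤ t → t ≤ T → ∀ x, |Φ s t x| ≤ k} with hF
  have hFclosed : ∀ k, IsClosed (F k) := by
    intro k
    refine isClosed_of_closure_subset fun s hs => ?_
    have hsI : s ∈ Icc (0:ℝ) T :=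
      closure_minimal (fun s hs => hs.1) isClosed_Icc hs
    refine ⟨hsI, fun t hst htT x => ?_⟩
    have h1 := hΦcont ((s, t), x) ⟨⟨hsI.1, hst, htT⟩, mem_univ _⟩
    have h2 : Tendsto (fun σ : ℝ => ((σ, max σ t), x)) (𝓝[F k] s) (𝓝[simplexST T ×ˢ univ] ((s, t), x)) := by
      apply tendsto_nhdsWithin_of_tendsto_nhds_of_eventually_within
      · have : Continuous (fun σ : ℝ => ((σ, max σ t), x)) := by fun_prop
        have h3 := (this.tendsto s).mono_left (nhdsWithin_le_nhds (s := F k))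
        rwa [max_eq_right hst] at h3
      · filter_upwards [self_mem_nhdsWithin] with σ hσ
        exact ⟨⟨hσ.1.1, le_max_left _ _, max_le hσ.1.2 htT⟩, mem_univ _⟩
    have h3 : Tendsto _ _ _ := (Tendsto.comp h1 h2).abs
    haveI : (𝓝[F k] s).NeBot := mem_closure_iff_nhdsWithin_neBot.1 hs
    refine le_of_tendsto h3 ?_
    filter_upwards [self_mem_nhdsWithin] with σ hσ
    exact hσ.2 (max σ t) (le_max_left _ _) (max_le hσ.1.2 htT) x
  have step1 : ∀ ε : ℝ, |ε| = 1 → ∀ t ∈ Icc 0 T, ∀ x,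
      (∫ s in (0:ℝ)..t, ε * Φ s t x) ≤ a ^ 2 + K * T := by
    intro ε hε t ht x
    have hθm : ∀ k, Measurable (fun s => (F k).indicator (fun _ => ε) s) := fun k =>
      measurable_const.indicator (hFclosed k).measurableSet
    have hθ1 : ∀ k s, |(F k).indicator (fun _ => ε) s| ≤ 1 := by
      intro k s
      by_cases hs : s ∈ F k
      · rw [indicator_of_mem hs, hε]
      · rw [indicator_of_notMem hs]; simp
    have hk : ∀ k : ℕ, (∫ s in (0:ℝ)..t, (F k).indicator (fun _ => ε) s * Φ s t x) ≤ a ^ 2 + K * T := by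
      intro k
      have hbound : ∀ t ∈ Icc 0 T, ∀ x,
          (∫ s in (0:ℝ)..t, (F k).indicator (fun _ => ε) s * Φ s t x) ≤ k * T := by
        intro t ht x
        refine (le_abs_self _).trans ?_
        rw [← Real.norm_eq_abs]
        refine (intervalIntegral.norm_integral_le_of_norm_le_const (C := k) ?_).trans ?_
        · intro s hs
          rw [uIoc_of_le ht.1] at hs
          by_cases hsF : s ∈ F k
          · rw [indicator_of_mem hsF, Real.norm_eq_abs, abs_mul, hε, one_mul]
            exact hsF.2 t hs.2 ht.2 x
          · rw [indicator_of_notMem hsF]; simp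
        · rw [sub_zero, abs_of_nonneg ht.1]
          have := ht.2
          gcongr
      have hAsq : ∀ t ∈ Icc 0 T, ∀ x, A t x ^ 2 ≤ a ^ 2 := fun t ht x => by
        rw [← sq_abs]; exact pow_le_pow_left₀ (abs_nonneg _) (ha t ht x) 2
      have := core _ (hθm k) (hθ1 k) (fun t x => A t x ^ 2 + (-a ^ 2 - K * t)) ?_ ?_ ?_ ?_ t ht x
      · have h2 : K * t ≤ K * T := by have := ht.2; gcongr
        nlinarith [sq_nonneg (A t x)]
      · refine (hAsmooth.continuousOn.pow 2).add (Continuous.continuousOn ?_)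
        fun_prop
      · intro x
        have := hAsq 0 ⟨le_rfl, hT.le⟩ x
        nlinarith
      · refine ⟨k * T, fun t ht x => ?_⟩
        have h1 := hbound t ht x
        have h2 := hAsq t ht x
        have h3 : 0 ≤ K * t := mul_nonneg hK0 ht.1
        linarith
      · intro t ht htT x
        have htm := hTm t ht htT
        refine ⟨_, 2 * A t x * hormanderL X (A t) x - K, |g t x|, LrOp_E1 X (hAs t htm) _ x, ?_, ?_, ?_⟩
        · have h1 := (hApde t htm x).pow 2
          have h2 : HasDerivWithinAt (fun s : ℝ => -a ^ 2 - K * s) (-K) (Icc 0 T) t := by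
            have := ((hasDerivAt_id t).const_mul K).const_sub (-a ^ 2)
            simpa using this.hasDerivWithinAt
          refine (h1.add h2).congr_deriv ?_
          simp; ring
        · intro δ hδ
          have h1 := (hdiag t ht htT x).abs.eventually_le_const (show |g t x| < |g t x| + δ by linarith)
          filter_upwards [h1] with s hs
          refine (le_abs_self _).trans ?_
          rw [abs_mul]
          have := mul_le_mul_of_nonneg_right (hθ1 k s) (abs_nonneg (Φ s t x))
          linarith
        · have := hK t x
          linarith
    obtain ⟨D, hD⟩ := hΦloc {x} isCompact_singleton
    have hlim : Tendsto (fun k : ℕ => ∫ s in (0:ℝ)..t, (F k).indicator (fun _ => ε) s * Φ s t x) atTop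
        (𝓝 (∫ s in (0:ℝ)..t, ε * Φ s t x)) := by
      refine intervalIntegral.tendsto_integral_filter_of_dominated_convergence (fun _ => D) ?_ ?_ ?_ ?_
      · refine Eventually.of_forall fun k => ?_
        have := th_int (hθm k) (hθ1 k) (ii_of (hsl x t ht) le_rfl ht.1 le_rfl)
        rw [intervalIntegrable_iff] at this
        exact this.aestronglyMeasurable
      · refine Eventually.of_forall fun k => Eventually.of_forall fun s hs => ?_
        rw [uIoc_of_le ht.1] at hs
        rw [Real.norm_eq_abs, abs_mul]
        have h1 := mul_le_mul_of_nonneg_right (hθ1 k s) (abs_nonneg (Φ s t x))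
        have h2 := (hD (s, t) ⟨hs.1.le, hs.2, ht.2⟩ x rfl).1
        simp only at h2
        linarith
      · exact intervalIntegrable_const
      · refine Eventually.of_forall fun s hs => ?_
        rw [uIoc_of_le ht.1] at hs
        have hsI : s ∈ Icc (0:ℝ) T := ⟨hs.1.le, hs.2.trans ht.2⟩
        obtain ⟨C, hC⟩ := hΦbdd0 s hsI
        obtain ⟨N, hN⟩ := exists_nat_ge C
        refine tendsto_const_nhds.congr' ?_
        filter_upwards [eventually_ge_atTop N] with k hk
        have : s ∈ F k := ⟨hsI, fun t h1 h2 x => (hC t ⟨h1, h2⟩ x).trans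
          (hN.trans (by exact_mod_cast hk))⟩
        rw [indicator_of_mem this]
    exact le_of_tendsto' hlim hk
  -- Step 2: compare with `B`
  obtain ⟨β, hβ⟩ := hBbdd
  have step2 : ∀ ε : ℝ, |ε| = 1 → ∀ t ∈ Icc 0 T, ∀ x,
      (∫ s in (0:ℝ)..t, ε * Φ s t x) + (-ε) * B t x ≤ 0 := by
    intro ε hε
    refine core (fun _ => ε) measurable_const (fun _ => hε.le) (fun t x => (-ε) * B t x) ?_ ?_ ?_ ?_
    · exact continuousOn_const.mul hBsmooth.continuousOn
    · intro x; simp [hB0 x]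
    · refine ⟨a ^ 2 + K * T + β, fun t ht x => ?_⟩
      have h1 := step1 ε hε t ht x
      have h2 : (-ε) * B t x ≤ β := by
        refine (le_abs_self _).trans ?_
        rw [abs_mul, abs_neg, hε, one_mul]
        exact hβ t ht x
      linarith
    · intro t ht htT x
      have htm := hTm t ht htT
      refine ⟨(-ε) * hormanderL X (B t) x, (-ε) * (hormanderL X (B t) x + g t x), ε * g t x, ?_, ?_, ?_, ?_⟩
      · have h1 := (LrOp_tendsto (hBs t htm) x (drift X x) (fun i : Fin m => X i.succ x)).const_mul (-ε)
        rw [← hormanderL_eq] at h1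
        refine h1.congr fun r => ?_
        have := LrOp_sub_mul (drift X x) (fun i : Fin m => X i.succ x) (fun _ => 0) (B t) (-ε) x r
        simp only [zero_add] at this
        rw [this]; simp [LrOp]
      · have h1 := hGpde t htm x 0
        rw [barLh_eq X h t (hAs t htm) (hBs t htm) x] at h1
        simp only [mul_zero, zero_add] at h1
        exact h1.const_mul (-ε)
      · intro δ hδ
        exact ((hdiag t ht htT x).const_mul ε).eventually_le_const (by linarith)
      · linarith
  intro t ht x
  have h1 := step2 1 (by simp) t ht x
  have h2 := step2 (-1) (by simp) t ht x
  rw [intervalIntegral.integral_const_mul] at h1 h2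
  linarith
end

section
/- (Smooth density criterion, functional-analytic core of Theorem 3.1 and Lemma 3.6.) Let μ be a finite Borel measure on ℝ^d. Suppose that for every multi-index α there exists a constant C_α such that |∫_{ℝ^d} ∂^α f dμ| ≤ C_α · sup_{x ∈ ℝ^d} |f(x)| for every smooth compactly supported function f : ℝ^d → ℝ. Then μ is absolutely continuous with respect to Lebesgue measure and its density can be chosen to be a smooth function p : ℝ^d → [0,∞) all of whose derivatives are bounded; i.e. μ has a smooth density. -/
open MeasureTheory
open scoped BigOperators


lemma aux_decay {d : ℕ} (μ : Measure (Fin d → ℝ)) [IsFiniteMeasure μ] (n : ℕ) (e : Fin d → ℝ)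
    (C : ℝ)
    (hC : ∀ f : (Fin d → ℝ) → ℝ, ContDiff ℝ (⊤ : ℕ∞) f → HasCompactSupport f →
        |∫ x, iteratedFDeriv ℝ n f x (fun _ => e) ∂μ| ≤ C * ⨆ x, |f x|)
    (g : ℝ → ℝ) (hg : ContDiff ℝ (⊤ : ℕ∞) g) (hgb : ∀ k x, |iteratedDeriv k g x| ≤ 1)
    (L : (Fin d → ℝ) →L[ℝ] ℝ) :
    |∫ x, (L e) ^ n * iteratedDeriv n g (L x) ∂μ| ≤ |C| := by
  let χ : ContDiffBump (0 : Fin d → ℝ) := ⟨1, 2, by norm_num, by norm_num⟩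
  have hχ : ContDiff ℝ (⊤ : ℕ∞) χ := χ.contDiff
  have hχc : HasCompactSupport χ := χ.hasCompactSupport
  have hb : ∀ k : ℕ, ∃ B : ℝ, ∀ x, ‖iteratedFDeriv ℝ k χ x‖ ≤ B := fun k =>
    Continuous.bounded_above_of_compact_support
      (hχ.continuous_iteratedFDeriv (by exact_mod_cast le_top)) (hχc.iteratedFDeriv k)
  choose B hB using hb
  let a : ℕ → ℝ := fun N => ((N : ℝ) + 1)⁻¹
  have ha0 : ∀ N, 0 < a N := fun N => by positivity
  have ha1 : ∀ N, a N ≤ 1 := fun N => inv_le_one_of_one_le₀ (by simp)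
  have hG : ContDiff ℝ (⊤ : ℕ∞) (g ∘ L) := hg.comp L.contDiff
  let X : ℕ → (Fin d → ℝ) → ℝ := fun N x => χ (a N • x)
  have hX : ∀ N, ContDiff ℝ (⊤ : ℕ∞) (X N) := fun N => hχ.comp (contDiff_const_smul (a N))
  let f : ℕ → (Fin d → ℝ) → ℝ := fun N x => X N x * (g ∘ L) x
  have hf : ∀ N, ContDiff ℝ (⊤ : ℕ∞) (f N) := fun N => (hX N).mul hG
  have hfc : ∀ N, HasCompactSupport (f N) := fun N =>
    HasCompactSupport.mul_right (hχc.comp_smul (ha0 N).ne')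
  have hf1 : ∀ N x, |f N x| ≤ 1 := fun N x => by
    have h1 := hgb 0 (L x)
    simp only [iteratedDeriv_zero] at h1
    have h2 : |X N x| ≤ 1 := by
      rw [abs_of_nonneg χ.nonneg]; exact χ.le_one
    simp only [f, abs_mul]
    exact mul_le_one₀ h2 (abs_nonneg _) h1
  have hfb : ∀ N, |∫ x, iteratedFDeriv ℝ n (f N) x (fun _ => e) ∂μ| ≤ |C| := fun N => by
    have h0 : 0 ≤ ⨆ x, |f N x| := Real.iSup_nonneg fun x => abs_nonneg _
    have h1 : ⨆ x, |f N x| ≤ 1 := ciSup_le (hf1 N)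
    calc _ ≤ C * ⨆ x, |f N x| := hC _ (hf N) (hfc N)
      _ ≤ |C| * ⨆ x, |f N x| := by gcongr; exact le_abs_self C
      _ ≤ |C| * 1 := by gcongr
      _ = |C| := mul_one _
  have hGd : ∀ k x, iteratedFDeriv ℝ k (g ∘ L) x =
      (iteratedFDeriv ℝ k g (L x)).compContinuousLinearMap fun _ => L := fun k x =>
    L.iteratedFDeriv_comp_right hg x (by exact_mod_cast le_top)
  have hGb : ∀ k x, ‖iteratedFDeriv ℝ k (g ∘ L) x‖ ≤ ‖L‖ ^ k := fun k x => by
    rw [hGd]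
    refine (ContinuousMultilinearMap.norm_compContinuousLinearMap_le _ _).trans ?_
    rw [norm_iteratedFDeriv_eq_norm_iteratedDeriv]
    simpa using mul_le_mul_of_nonneg_right (hgb k (L x)) (by positivity)
  have hXb : ∀ N k x, ‖iteratedFDeriv ℝ k (X N) x‖ ≤ B k := fun N k x => by
    have : iteratedFDeriv ℝ k (X N) = fun x ↦ (a N) ^ k • iteratedFDeriv ℝ k χ (a N • x) :=
      iteratedFDeriv_comp_const_smul (a N) (hχ.of_le (by exact_mod_cast le_top))
    rw [this]
    simp only [norm_smul, norm_pow, Real.norm_eq_abs, abs_of_pos (ha0 N)]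
    calc _ ≤ 1 * ‖iteratedFDeriv ℝ k χ (a N • x)‖ := by
          gcongr; exact pow_le_one₀ (ha0 N).le (ha1 N)
      _ ≤ B k := by rw [one_mul]; exact hB k _
  have hlim : Filter.Tendsto (fun N => ∫ x, iteratedFDeriv ℝ n (f N) x (fun _ => e) ∂μ)
      Filter.atTop (nhds (∫ x, iteratedFDeriv ℝ n (g ∘ L) x (fun _ => e) ∂μ)) := by
    refine tendsto_integral_of_dominated_convergence
      (fun _ => (∑ i ∈ Finset.range (n + 1), (n.choose i : ℝ) * B i * ‖L‖ ^ (n - i)) *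
        ∏ _i : Fin n, ‖e‖) ?_ (integrable_const _) ?_ ?_
    · intro N
      refine Continuous.aestronglyMeasurable ?_
      exact (ContinuousMultilinearMap.apply ℝ (fun _ : Fin n => (Fin d → ℝ)) ℝ
        (fun _ => e)).continuous.comp
        ((hf N).continuous_iteratedFDeriv (by exact_mod_cast le_top))
    · intro N
      refine Filter.Eventually.of_forall fun x => ?_
      refine (ContinuousMultilinearMap.le_opNorm _ _).trans ?_
      gcongr
      refine (norm_iteratedFDeriv_mul_le (hX N) hG x (by exact_mod_cast le_top)).trans ?_
      gcongr with i hi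
      · exact mul_nonneg (by positivity) ((norm_nonneg _).trans (hXb N i x))
      · exact hXb N i x
      · exact hGb _ x
    · refine Filter.Eventually.of_forall fun x => ?_
      refine tendsto_const_nhds.congr' ?_
      obtain ⟨M, hM⟩ := exists_nat_gt ‖x‖
      filter_upwards [Filter.eventually_ge_atTop M] with N hN
      have : f N =ᶠ[nhds x] (g ∘ L) := by
        have hx : ‖x‖ < N := hM.trans_le (by exact_mod_cast hN)
        have : ∀ᶠ y in nhds x, ‖y‖ < N := continuous_norm.continuousAt.eventually_lt_const hx
        filter_upwards [this] with y hy
        have : X N y = 1 := by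
          apply χ.one_of_mem_closedBall
          rw [mem_closedBall_zero_iff, norm_smul, Real.norm_eq_abs, abs_of_pos (ha0 N)]
          change ((N : ℝ) + 1)⁻¹ * ‖y‖ ≤ 1
          rw [inv_mul_le_iff₀ (by positivity)]
          linarith
        simp [f, this]
      rw [(Filter.EventuallyEq.iteratedFDeriv ℝ this n).eq_of_nhds]
  have := le_of_tendsto' hlim.abs hfb
  have h2 : ∀ x, iteratedFDeriv ℝ n (g ∘ L) x (fun _ => e) =
      (L e) ^ n * iteratedDeriv n g (L x) := fun x => by
    rw [hGd]
    simp [iteratedFDeriv_apply_eq_iteratedDeriv_mul_prod]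
  simpa only [h2] using this

lemma aux_measure {E : Type*} [NormedAddCommGroup E] [NormedSpace ℝ E] [FiniteDimensional ℝ E]
    [MeasurableSpace E] [BorelSpace E] (μ ν : Measure E) [IsFiniteMeasure μ]
    [ν.IsAddHaarMeasure]
    (p : E → ℝ) (hp : Continuous p)
    (h : ∀ g : E → ℝ, ContDiff ℝ (⊤ : ℕ∞) g → HasCompactSupport g →
      ∫ x, g x ∂μ = ∫ x, g x * p x ∂ν) :
    (∀ x, 0 ≤ p x) ∧ μ = ν.withDensity (fun x => ENNReal.ofReal (p x)) := by
  let ρ : Measure E := μ + ν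
  have hμρ : μ ≪ ρ := Measure.AbsolutelyContinuous.rfl.add_right ν
  have hνρ : ν ≪ ρ := by
    have : ν ≪ ν + μ := Measure.AbsolutelyContinuous.rfl.add_right μ
    rwa [add_comm] at this
  have e1 : ρ.withDensity (μ.rnDeriv ρ) = μ := Measure.withDensity_rnDeriv_eq _ _ hμρ
  have e2 : ρ.withDensity (ν.rnDeriv ρ) = ν := Measure.withDensity_rnDeriv_eq _ _ hνρ
  let f1 : E → ℝ := fun x => (μ.rnDeriv ρ x).toReal
  let f2 : E → ℝ := fun x => (ν.rnDeriv ρ x).toReal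
  have i1 : ∀ g : E → ℝ, ∫ x, g x ∂μ = ∫ x, g x * f1 x ∂ρ := fun g => by
    rw [← integral_rnDeriv_smul hμρ]
    simp [f1, mul_comm]
  have i2 : ∀ g : E → ℝ, ∫ x, g x ∂ν = ∫ x, g x * f2 x ∂ρ := fun g => by
    rw [← integral_rnDeriv_smul hνρ]
    simp [f2, mul_comm]
  have l1 : LocallyIntegrable f1 ρ :=
    (Measure.integrable_toReal_rnDeriv).locallyIntegrable
  have l2 : LocallyIntegrable f2 ρ := by
    rw [locallyIntegrable_iff]
    intro K hK
    refine integrable_toReal_of_lintegral_ne_top (Measure.measurable_rnDeriv _ _).aemeasurable ?_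
    exact ((Measure.setLIntegral_rnDeriv_le K).trans_lt hK.measure_lt_top).ne
  have l3 : LocallyIntegrable (fun x => p x * f2 x) ρ := by
    have := l2.smul_continuous hp
    simpa [mul_comm] using this
  have key : ∀ᵐ x ∂ρ, f1 x = p x * f2 x := by
    refine ae_eq_of_integral_contDiff_smul_eq l1 l3 fun g hg hgc => ?_
    simp only [smul_eq_mul]
    rw [← i1, h g hg hgc, i2]
    simp only [mul_assoc]
  have hf2 : ∀ᵐ x ∂ν, 0 < f2 x := by
    filter_upwards [Measure.rnDeriv_pos hνρ, hνρ.ae_le (Measure.rnDeriv_lt_top ν ρ)] with x h1 h2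
    exact ENNReal.toReal_pos h1.ne' h2.ne
  have hpae : ∀ᵐ x ∂ν, 0 ≤ p x := by
    filter_upwards [hf2, hνρ.ae_le key] with x h1 h2
    have : 0 ≤ f1 x := ENNReal.toReal_nonneg
    rw [h2] at this
    exact nonneg_of_mul_nonneg_left this h1
  have hp0 : ∀ x, 0 ≤ p x := by
    have hd : Dense {x | 0 ≤ p x} := Measure.dense_of_ae hpae
    have hc : IsClosed {x | 0 ≤ p x} := isClosed_le continuous_const hp
    intro x
    have := hd.closure_eq ▸ Set.mem_univ x
    rwa [hc.closure_eq] at this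
  refine ⟨hp0, ?_⟩
  have hm : Measurable fun x => ENNReal.ofReal (p x) := hp.measurable.ennreal_ofReal
  conv_rhs => rw [← e2]
  rw [← withDensity_mul _ (Measure.measurable_rnDeriv _ _) hm]
  conv_lhs => rw [← e1]
  refine withDensity_congr_ae ?_
  filter_upwards [key, Measure.rnDeriv_lt_top μ ρ, Measure.rnDeriv_lt_top ν ρ] with x h1 h2 h3
  rw [← ENNReal.ofReal_toReal h2.ne]
  change ENNReal.ofReal (f1 x) = ν.rnDeriv ρ x * _
  rw [h1, ENNReal.ofReal_mul (hp0 x), ENNReal.ofReal_toReal h3.ne, mul_comm]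

open scoped FourierTransform in
lemma aux_fourier {E : Type*} [NormedAddCommGroup E] [InnerProductSpace ℝ E]
    [FiniteDimensional ℝ E]
    [MeasurableSpace E] [BorelSpace E] (ν : Measure E) [IsFiniteMeasure ν]
    (hφ : ∀ n : ℕ, ∃ C : ℝ, ∀ ξ, ‖ξ‖ ^ n *
      ‖VectorFourier.fourierIntegral 𝐞 ν (-innerₗ E).flip (fun _ => (1 : ℂ)) ξ‖ ≤ C) :
    ∃ q : E → ℂ, ContDiff ℝ (⊤ : ℕ∞) q ∧
      (∀ n : ℕ, ∃ C : ℝ, ∀ x, ‖iteratedFDeriv ℝ n q x‖ ≤ C) ∧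
      ∀ g : E → ℝ, ContDiff ℝ (⊤ : ℕ∞) g → HasCompactSupport g →
        ∫ x, (g x : ℂ) ∂ν = ∫ x, (g x : ℂ) * q x := by
  set φ := VectorFourier.fourierIntegral 𝐞 ν (-innerₗ E).flip (fun _ => (1 : ℂ)) with hφd
  have hcL : Continuous fun p : E × E ↦ (-innerₗ E) p.1 p.2 := by
    simp only [LinearMap.neg_apply, innerₗ_apply_apply]
    fun_prop
  have hcL' : Continuous fun p : E × E ↦ (-innerₗ E).flip p.1 p.2 := by
    simp only [LinearMap.neg_apply, LinearMap.flip_apply, innerₗ_apply_apply]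
    fun_prop
  have hcont : Continuous φ := VectorFourier.fourierIntegral_continuous
    Real.continuous_fourierChar hcL' (integrable_const _)
  have hint : ∀ n : ℕ, Integrable (fun x => ‖x‖ ^ n * ‖φ x‖) := fun n => by
    obtain ⟨C1, h1⟩ := hφ 0
    obtain ⟨C2, h2⟩ := hφ (n + (volume : Measure E).integrablePower)
    exact integrable_of_le_of_pow_mul_le (fun x => by simpa using h1 x) h2
      hcont.aestronglyMeasurable
  have hint0 : Integrable φ := by
    have := hint 0
    simp only [pow_zero, one_mul] at this
    exact (integrable_norm_iff hcont.aestronglyMeasurable).1 this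
  refine ⟨𝓕 φ, Real.contDiff_fourier fun n _ => hint n, fun n => ?_, fun g hg hgc => ?_⟩
  · rw [Real.iteratedFDeriv_fourier (N := ⊤) (fun n _ => hint n) hcont.aestronglyMeasurable le_top]
    exact ⟨_, fun x => VectorFourier.norm_fourierIntegral_le_integral_norm _ _ _ _ _⟩
  · have hgC : ContDiff ℝ (⊤ : ℕ∞) (fun x => (g x : ℂ)) := Complex.ofRealCLM.contDiff.comp hg
    have hgCc : HasCompactSupport (fun x => (g x : ℂ)) := hgc.comp_left Complex.ofReal_zero
    let h : SchwartzMap E ℂ := hgCc.toSchwartzMap hgC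
    have hh : ∀ x, (g x : ℂ) = h x := fun x => rfl
    simp only [hh]
    have s1 : ∫ ξ, (𝓕 h) ξ • φ ξ = ∫ x, h x • 𝓕 φ x := by
      simpa using! VectorFourier.integral_fourierIntegral_smul_eq_flip (L := innerₗ E)
        Real.continuous_fourierChar continuous_inner h.integrable hint0
    have s2 : ∫ x, (𝓕⁻ (𝓕 h)) x • (1 : ℂ) ∂ν = ∫ ξ, (𝓕 h) ξ • φ ξ := by
      rw [SchwartzMap.fourierInv_coe]
      exact VectorFourier.integral_fourierIntegral_smul_eq_flip (L := -innerₗ E) (μ := volume) (ν := ν)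
        Real.continuous_fourierChar hcL (𝓕 h).integrable (integrable_const (1 : ℂ))
    rw [FourierTransform.fourierInv_fourier_eq] at s2
    simp only [smul_eq_mul, mul_one] at s1 s2
    rw [s2, s1]

open scoped FourierTransform in
lemma aux_phi {d : ℕ} (μ : Measure (Fin d → ℝ)) [IsFiniteMeasure μ]
    (hμ : ∀ (n : ℕ) (v : Fin n → Fin d), ∃ C : ℝ,
      ∀ f : (Fin d → ℝ) → ℝ, ContDiff ℝ (⊤ : ℕ∞) f → HasCompactSupport f →
        |∫ x, iteratedFDeriv ℝ n f x (fun k => Pi.single (v k) (1 : ℝ)) ∂μ| ≤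
          C * ⨆ x, |f x|) (m : ℕ) (i : Fin d) :
    ∃ C : ℝ, ∀ ξ : EuclideanSpace ℝ (Fin d), |ξ i| ^ (2 * m) *
      ‖VectorFourier.fourierIntegral 𝐞 (μ.map (WithLp.toLp 2))
        (-innerₗ (EuclideanSpace ℝ (Fin d))).flip (fun _ => (1 : ℂ)) ξ‖ ≤ C := by
  obtain ⟨C, hC⟩ := hμ (2 * m) (fun _ => i)
  refine ⟨|C| + |C|, fun ξ => ?_⟩
  let L : (Fin d → ℝ) →L[ℝ] ℝ := (2 * Real.pi) •
    ((innerSL ℝ ξ).comp (PiLp.continuousLinearEquiv 2 ℝ (fun _ : Fin d => ℝ)).symm.toContinuousLinearMap)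
  have hLe : L (Pi.single i 1) = 2 * Real.pi * ξ i := by
    simp [L, PiLp.inner_apply]
  have hφ : VectorFourier.fourierIntegral 𝐞 (μ.map (WithLp.toLp 2))
        (-innerₗ (EuclideanSpace ℝ (Fin d))).flip (fun _ => (1 : ℂ)) ξ =
        ∫ x, Complex.exp ((L x : ℂ) * Complex.I) ∂μ := by
    have hemb : MeasurableEmbedding (WithLp.toLp 2 : (Fin d → ℝ) → EuclideanSpace ℝ (Fin d)) :=
      (MeasurableEquiv.toLp 2 (Fin d → ℝ)).measurableEmbedding
    rw [Real.vector_fourierIntegral_eq_integral_exp_smul,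
      hemb.integral_map]
    refine integral_congr_ae (Filter.Eventually.of_forall fun x => ?_)
    simp [L]
  have hmeas : ∀ g : ℝ → ℂ, Continuous g → (∀ x, ‖g x‖ ≤ 1) →
      Integrable (fun x => g (L x)) μ := fun g hg hb =>
    Integrable.of_bound (hg.comp L.continuous).aestronglyMeasurable 1
      (Filter.Eventually.of_forall fun x => hb _)
  have hφ2 : ∫ x, Complex.exp ((L x : ℂ) * Complex.I) ∂μ =
      ((∫ x, Real.cos (L x) ∂μ : ℝ) : ℂ) + ((∫ x, Real.sin (L x) ∂μ : ℝ) : ℂ) * Complex.I := by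
    rw [← integral_complex_ofReal, ← integral_complex_ofReal, ← integral_mul_const, ← integral_add]
    · simp [Complex.exp_mul_I]
    · exact hmeas (fun t => (Real.cos t : ℂ)) (by fun_prop) (fun t => by
        simpa [-Complex.ofReal_cos] using Real.abs_cos_le_one t)
    · exact (hmeas (fun t => (Real.sin t : ℂ)) (by fun_prop) (fun t => by
        simpa [-Complex.ofReal_sin] using Real.abs_sin_le_one t)).mul_const _
  have h1 := aux_decay μ (2 * m) _ C hC Real.cos Real.contDiff_cos
    Real.abs_iteratedDeriv_cos_le_one L
  have h2 := aux_decay μ (2 * m) _ C hC Real.sin Real.contDiff_sin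
    Real.abs_iteratedDeriv_sin_le_one L
  rw [integral_const_mul, hLe, abs_mul, abs_pow] at h1 h2
  simp only [Real.iteratedDeriv_even_cos, Real.iteratedDeriv_even_sin, Pi.mul_apply, Pi.pow_apply,
    Pi.neg_apply, Pi.one_apply, integral_const_mul, abs_mul, abs_pow, abs_neg, abs_one, one_pow,
    one_mul] at h1 h2
  have hξ : |ξ i| ≤ |2| * |Real.pi| * |ξ i| := by
    have : (1 : ℝ) ≤ |2| * |Real.pi| := by
      rw [abs_of_pos Real.pi_pos, abs_of_pos two_pos]; linarith [Real.pi_gt_three]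
    exact le_mul_of_one_le_left (abs_nonneg _) this
  rw [hφ, hφ2]
  calc _ ≤ (|2| * |Real.pi| * |ξ i|) ^ (2 * m) *
        (|∫ x, Real.cos (L x) ∂μ| + |∫ x, Real.sin (L x) ∂μ|) := by
        gcongr
        refine (norm_add_le _ _).trans ?_
        simp
    _ ≤ |C| + |C| := by rw [mul_add]; exact add_le_add h1 h2

open scoped FourierTransform in
lemma aux_phi2 {d : ℕ} (φ : EuclideanSpace ℝ (Fin d) → ℂ)
    (hφ0 : ∃ C, ∀ ξ, ‖φ ξ‖ ≤ C)
    (h : ∀ (m : ℕ) (i : Fin d), ∃ C : ℝ, ∀ ξ : EuclideanSpace ℝ (Fin d),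
      |ξ i| ^ (2 * m) * ‖φ ξ‖ ≤ C) (n : ℕ) :
    ∃ C : ℝ, ∀ ξ, ‖ξ‖ ^ n * ‖φ ξ‖ ≤ C := by
  obtain ⟨C0, h0⟩ := hφ0
  choose C hC using h (n + 1)
  refine ⟨C0 + (d : ℝ) ^ n * ∑ i, C i, fun ξ => ?_⟩
  have h1 : ‖ξ‖ ^ n ≤ 1 + ‖ξ‖ ^ (2 * (n + 1)) := by
    rcases le_total ‖ξ‖ 1 with h | h
    · have := pow_le_one₀ (n := n) (norm_nonneg ξ) h
      have : 0 ≤ ‖ξ‖ ^ (2 * (n + 1)) := by positivity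
      linarith
    · have := pow_le_pow_right₀ h (show n ≤ 2 * (n + 1) by omega)
      linarith
  have h2 : ‖ξ‖ ^ (2 * (n + 1)) ≤ (d : ℝ) ^ n * ∑ i, |ξ i| ^ (2 * (n + 1)) := by
    rw [pow_mul, EuclideanSpace.norm_sq_eq]
    have := pow_sum_le_card_mul_sum_pow (s := (Finset.univ : Finset (Fin d)))
      (f := fun i => |ξ i| ^ 2) (fun i _ => by positivity) n
    simp only [Finset.card_univ, Fintype.card_fin] at this
    simp only [Real.norm_eq_abs, pow_mul]
    exact this
  calc ‖ξ‖ ^ n * ‖φ ξ‖ ≤ (1 + (d : ℝ) ^ n * ∑ i, |ξ i| ^ (2 * (n + 1))) * ‖φ ξ‖ := by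
        gcongr; linarith
    _ = ‖φ ξ‖ + (d : ℝ) ^ n * ∑ i, |ξ i| ^ (2 * (n + 1)) * ‖φ ξ‖ := by
        rw [add_mul, one_mul, mul_assoc, Finset.sum_mul]
    _ ≤ _ := by
        gcongr with i
        · exact h0 ξ
        · exact hC i ξ

/-- Smooth density criterion (functional-analytic core of Theorem 3.1 and Lemma 3.6):
if a finite Borel measure `μ` on `ℝ^d` satisfies, for every multi-index (encoded as an
iterated directional derivative along coordinate directions `v : Fin n → Fin d`), a bound
`|∫ ∂^α f dμ| ≤ C_α · sup |f|` over smooth compactly supported `f`, then `μ` is absolutely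
continuous with respect to Lebesgue measure with a smooth nonnegative density all of whose
derivatives are bounded. -/
theorem smooth_density_criterion (d : ℕ) (μ : Measure (Fin d → ℝ)) [IsFiniteMeasure μ]
    (hμ : ∀ (n : ℕ) (v : Fin n → Fin d), ∃ C : ℝ,
      ∀ f : (Fin d → ℝ) → ℝ, ContDiff ℝ (⊤ : ℕ∞) f → HasCompactSupport f →
        |∫ x, iteratedFDeriv ℝ n f x (fun k => Pi.single (v k) (1 : ℝ)) ∂μ| ≤
          C * ⨆ x, |f x|) :
    μ ≪ volume ∧
    ∃ p : (Fin d → ℝ) → ℝ, ContDiff ℝ (⊤ : ℕ∞) p ∧ (∀ x, 0 ≤ p x) ∧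
      (∀ n : ℕ, ∃ C : ℝ, ∀ x, ‖iteratedFDeriv ℝ n p x‖ ≤ C) ∧
      μ = volume.withDensity (fun x => ENNReal.ofReal (p x)) := by
  let T : (Fin d → ℝ) ≃L[ℝ] EuclideanSpace ℝ (Fin d) :=
    (PiLp.continuousLinearEquiv 2 ℝ (fun _ : Fin d => ℝ)).symm
  have hT : ∀ x, T x = WithLp.toLp 2 x := fun x => rfl
  obtain ⟨q, hq, hqb, hqi⟩ := aux_fourier (μ.map (WithLp.toLp 2))
    (fun n => aux_phi2 _ ⟨_, fun ξ =>
      VectorFourier.norm_fourierIntegral_le_integral_norm _ _ _ _ ξ⟩ (aux_phi μ hμ) n)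
  let R : ℂ →L[ℝ] ℝ := Complex.reCLM
  let p : (Fin d → ℝ) → ℝ := (R ∘ q) ∘ T
  have hRq : ContDiff ℝ (⊤ : ℕ∞) (R ∘ q) := R.contDiff.comp hq
  have hp : ContDiff ℝ (⊤ : ℕ∞) p := hRq.comp T.contDiff
  have hpb : ∀ n : ℕ, ∃ C : ℝ, ∀ x, ‖iteratedFDeriv ℝ n p x‖ ≤ C := fun n => by
    obtain ⟨C, hC⟩ := hqb n
    refine ⟨‖R‖ * C * ∏ _i : Fin n, ‖(T : (Fin d → ℝ) →L[ℝ] EuclideanSpace ℝ (Fin d))‖,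
      fun x => ?_⟩
    have e1 : iteratedFDeriv ℝ n p x = (iteratedFDeriv ℝ n (R ∘ q) (T x)).compContinuousLinearMap
        fun _ => (T : (Fin d → ℝ) →L[ℝ] EuclideanSpace ℝ (Fin d)) :=
      ContinuousLinearMap.iteratedFDeriv_comp_right
        (T : (Fin d → ℝ) →L[ℝ] EuclideanSpace ℝ (Fin d)) hRq x (by exact_mod_cast le_top)
    rw [e1]
    refine (ContinuousMultilinearMap.norm_compContinuousLinearMap_le _ _).trans ?_
    gcongr
    refine (R.norm_iteratedFDeriv_comp_left hq.contDiffAt (by exact_mod_cast le_top)).trans ?_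
    gcongr
    exact hC _
  obtain ⟨h0, hd⟩ := aux_measure μ volume p hp.continuous (fun g hg hgc => by
    let G : EuclideanSpace ℝ (Fin d) → ℝ := g ∘ T.symm
    have hG : ContDiff ℝ (⊤ : ℕ∞) G := hg.comp T.symm.contDiff
    have hGc : HasCompactSupport G := hgc.comp_homeomorph T.symm.toHomeomorph
    have h1 := hqi G hG hGc
    have hemb : MeasurableEmbedding (WithLp.toLp 2 : (Fin d → ℝ) → EuclideanSpace ℝ (Fin d)) :=
      (MeasurableEquiv.toLp 2 (Fin d → ℝ)).measurableEmbedding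
    rw [hemb.integral_map,
      ← (PiLp.volume_preserving_toLp (Fin d)).integral_comp
        hemb] at h1
    have hGg : ∀ x, G (WithLp.toLp 2 x) = g x := fun x => rfl
    have hGg' : ∀ x, G ((MeasurableEquiv.toLp 2 (Fin d → ℝ)) x) = g x := fun x => rfl
    simp only [hGg, hGg'] at h1
    have h2 := congrArg Complex.re h1
    rw [integral_complex_ofReal, Complex.ofReal_re] at h2
    rw [h2]
    have hi : Integrable (fun x => (g x : ℂ) * q (WithLp.toLp 2 x)) := by
      refine Continuous.integrable_of_hasCompactSupport ?_ ?_
      · exact (Complex.continuous_ofReal.comp hg.continuous).mul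
          (hq.continuous.comp T.continuous)
      · exact (hgc.comp_left (g := ((↑) : ℝ → ℂ)) Complex.ofReal_zero).mul_right
    have h3 := Complex.reCLM.integral_comp_comm hi
    simp only [Complex.reCLM_apply] at h3
    rw [← h3]
    refine integral_congr_ae (Filter.Eventually.of_forall fun x => ?_)
    simp [p, R, hT])
  refine ⟨?_, p, hp, h0, hpb, hd⟩
  rw [hd]
  exact withDensity_absolutelyContinuous _ _
end
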